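/- There is a universal constant C such that for every weighted connected graph G = (V,E,w) with n = |V| ≥ 4 vertices there exist a finite collection τ = {T_1, …, T_h} of spanning trees of G, each a subgraph of G, and a probability distribution Π over τ such that for every edge e ∈ E, the expected stretch E_{T←Π}[stretch_T(e)] ≤ C · (log n)^2 · log log n. -/

import Mathlib

open scoped Classical

structure WGraph (V : Type) (E : Type) where
  ends : E → V × V
  w : E → ℝ
  w_pos : ∀ e, 0 < w e

namespace WGraph

variable {V E : Type}

/-- The length of an edge is the reciprocal of its weight. -/
noncomputable def len (G : WGraph V E) (e : E) : ℝ := 1 / G.w e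

/-- A walk in a multigraph, recorded as a sequence of edge traversals. -/
inductive Walk (G : WGraph V E) : V → V → Type
  | nil (v : V) : Walk G v v
  | cons (u v x : V) (e : E)
      (h : G.ends e = (u, v) ∨ G.ends e = (v, u))
      (p : Walk G v x) : Walk G u x

/-- The length of a walk: the sum of the lengths of its edges. -/
noncomputable def Walk.length {G : WGraph V E} : ∀ {u v : V}, G.Walk u v → ℝ
  | _, _, .nil _ => 0
  | _, _, .cons _ _ _ e _ p => G.len e + Walk.length p

/-- The list of vertices visited by a walk. -/
def Walk.support {G : WGraph V E} : ∀ {u v : V}, G.Walk u v → List V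
  | _, _, .nil v => [v]
  | _, _, .cons u _ _ _ _ p => u :: Walk.support p

def Connected (G : WGraph V E) : Prop := ∀ u v : V, Nonempty (G.Walk u v)

/-- Shortest-path distance. -/
noncomputable def dist (G : WGraph V E) (u v : V) : ℝ :=
  sInf {l | ∃ p : G.Walk u v, p.length = l}

/-- Shortest-path distance inside the subgraph induced on `A`. -/
noncomputable def distOn (G : WGraph V E) (A : Set V) (u v : V) : ℝ :=
  sInf {l | ∃ p : G.Walk u v, (∀ z ∈ p.support, z ∈ A) ∧ p.length = l}

/-- The distance from a vertex to a set of vertices. -/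
noncomputable def distToSet (G : WGraph V E) (u : V) (S : Set V) : ℝ :=
  sInf {l | ∃ s ∈ S, G.dist u s = l}

/-- The distance from a vertex to a set, within the subgraph induced on `A`. -/
noncomputable def distToSetOn (G : WGraph V E) (A : Set V) (u : V) (S : Set V) : ℝ :=
  sInf {l | ∃ s ∈ S, G.distOn A u s = l}

/-- radius(G,x): the smallest `r` such that every vertex is within distance `r` of `x`. -/
noncomputable def radius (G : WGraph V E) (x : V) : ℝ :=
  sInf {r | ∀ v : V, G.dist x v ≤ r}

/-- The radius of the subgraph induced on `A`, about `x`. -/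
noncomputable def radiusOn (G : WGraph V E) (A : Set V) (x : V) : ℝ :=
  sInf {r | ∀ v ∈ A, G.distOn A x v ≤ r}

/-- The subgraph induced on `A` is connected. -/
def ConnectedOn (G : WGraph V E) (A : Set V) : Prop :=
  ∀ u ∈ A, ∀ v ∈ A, ∃ p : G.Walk u v, ∀ z ∈ p.support, z ∈ A

/-- The spanning subgraph with edge set `T`. -/
def restrictE (G : WGraph V E) (T : Set E) : WGraph V T where
  ends e := G.ends e.1
  w e := G.w e.1
  w_pos e := G.w_pos e.1

/-- `T` is the edge set of a spanning tree of `G` (a subgraph of `G`). -/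
def IsSpanningTree [Fintype V] (G : WGraph V E) (T : Finset E) : Prop :=
  (G.restrictE (T : Set E)).Connected ∧ T.card + 1 = Fintype.card V

/-- stretch_T(u,v) = dist_T(u,v)/d(u,v) for the edge e = (u,v). -/
noncomputable def stretch (G : WGraph V E) (T : Finset E) (e : E) : ℝ :=
  (G.restrictE (T : Set E)).dist (G.ends e).1 (G.ends e).2 / G.len e

/-- The average stretch over all edges. -/
noncomputable def avestretch [Fintype E] (G : WGraph V E) (T : Finset E) : ℝ :=
  (∑ e : E, G.stretch T e) / (Fintype.card E : ℝ)

/-- The Alon–Karp–Peleg–West stretch: dist_T(u,v)/dist_G(u,v). -/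
noncomputable def stretchAKPW (G : WGraph V E) (T : Finset E) (e : E) : ℝ :=
  (G.restrictE (T : Set E)).dist (G.ends e).1 (G.ends e).2 /
    G.dist (G.ends e).1 (G.ends e).2

/-- The average AKPW stretch over all edges. -/
noncomputable def avestretchAKPW [Fintype E] (G : WGraph V E) (T : Finset E) : ℝ :=
  (∑ e : E, G.stretchAKPW T e) / (Fintype.card E : ℝ)

/-- The ball of radius `r` around `x`. -/
def ball (G : WGraph V E) (r : ℝ) (x : V) : Set V := {v | G.dist x v ≤ r}

/-- The ball shell of radius `r` around `x`. -/
def ballShell (G : WGraph V E) (r : ℝ) (x : V) : Set V :=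
  {u | u ∉ G.ball r x ∧ ∃ e : E, ∃ z ∈ G.ball r x,
    (G.ends e = (u, z) ∨ G.ends e = (z, u)) ∧ G.dist x u = G.dist x z + G.len e}

/-- The set of edges with exactly one endpoint in `S`. -/
def bdry (G : WGraph V E) (S : Set V) : Set E :=
  {e | ((G.ends e).1 ∈ S ∧ (G.ends e).2 ∉ S) ∨ ((G.ends e).1 ∉ S ∧ (G.ends e).2 ∈ S)}

/-- The set of edges with both endpoints in `S`. -/
def edgesIn (G : WGraph V E) (S : Set V) : Set E :=
  {e | (G.ends e).1 ∈ S ∧ (G.ends e).2 ∈ S}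

/-- The set of edges with one endpoint in `S` and the other in `T`. -/
def edgesBetween (G : WGraph V E) (S T : Set V) : Set E :=
  {e | ((G.ends e).1 ∈ S ∧ (G.ends e).2 ∈ T) ∨ ((G.ends e).1 ∈ T ∧ (G.ends e).2 ∈ S)}

/-- vol(S): the number of edges with at least one endpoint in `S`. -/
noncomputable def volV (G : WGraph V E) (S : Set V) : ℕ :=
  {e : E | (G.ends e).1 ∈ S ∨ (G.ends e).2 ∈ S}.ncard

/-- cost(F): the sum of the weights of the edges in `F`. -/
noncomputable def cost [Fintype E] (G : WGraph V E) (F : Set E) : ℝ :=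
  ∑ e : E, F.indicator G.w e

/-- A star-decomposition of `G` with center `x0`, parts `P i`, anchors `x i`,
`y i ∈ P 0`, and bridge edges `b i` for `i ≠ 0`. -/
structure IsStarDecomp (G : WGraph V E) (x0 : V) (k : ℕ)
    (P : Fin (k + 1) → Set V) (x y : Fin (k + 1) → V)
    (b : Fin (k + 1) → E) : Prop where
  disj : ∀ i j, i ≠ j → Disjoint (P i) (P j)
  cover : ⋃ i, P i = Set.univ
  center : x0 ∈ P 0
  conn : ∀ i, G.ConnectedOn (P i)
  anchor : ∀ i, x i ∈ P i
  x0eq : x 0 = x0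
  bridge : ∀ i, i ≠ 0 → y i ∈ P 0 ∧
    (G.ends (b i) = (x i, y i) ∨ G.ends (b i) = (y i, x i))

/-- A (δ,ε)-star-decomposition. -/
def IsStarDecompDE (G : WGraph V E) (x0 : V) (δ ε : ℝ) (k : ℕ)
    (P : Fin (k + 1) → Set V) (x y : Fin (k + 1) → V)
    (b : Fin (k + 1) → E) : Prop :=
  G.IsStarDecomp x0 k P x y b ∧
  δ * G.radius x0 ≤ G.radiusOn (P 0) x0 ∧
  G.radiusOn (P 0) x0 ≤ (1 - δ) * G.radius x0 ∧
  ∀ i, i ≠ 0 →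
    G.radiusOn (P 0) x0 + G.len (b i) + G.radiusOn (P i) (x i) ≤
      (1 + ε) * G.radius x0

/-- A concentric system in `G` (indexed by nonnegative radii). -/
structure IsConcentric (G : WGraph V E) (L : ℝ → Set V) : Prop where
  nonempty : (L 0).Nonempty
  mono : ∀ r r' : ℝ, 0 ≤ r → r < r' → L r ⊆ L r'
  closed : ∀ r : ℝ, 0 ≤ r → ∀ e : E,
    ((G.ends e).1 ∈ L r → (G.ends e).2 ∈ L (r + G.len e)) ∧
    ((G.ends e).2 ∈ L r → (G.ends e).1 ∈ L (r + G.len e))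

/-- The total length of the traversals of a walk that are not forward
(with respect to `S`). -/
noncomputable def Walk.coneCost {G : WGraph V E} (S : Set V) :
    ∀ {u v : V}, G.Walk u v → ℝ
  | _, _, .nil _ => 0
  | _, _, .cons a c _ e _ p =>
      (if G.distToSet a S + G.len e = G.distToSet c S then 0 else G.len e) +
        Walk.coneCost S p

/-- The cone of width `l` around `v` induced by `S`. -/
def cone (G : WGraph V E) (S : Set V) (l : ℝ) (v : V) : Set V :=
  {u | ∃ p : G.Walk v u, Walk.coneCost S p ≤ l}

/-- `coneCost` computed within the subgraph induced on `A`. -/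
noncomputable def Walk.coneCostOn {G : WGraph V E} (A S : Set V) :
    ∀ {u v : V}, G.Walk u v → ℝ
  | _, _, .nil _ => 0
  | _, _, .cons a c _ e _ p =>
      (if G.distToSetOn A a S + G.len e = G.distToSetOn A c S then 0 else G.len e) +
        Walk.coneCostOn A S p

/-- The cone of width `l` around `v` induced by `S`, computed in the subgraph
induced on `A`. -/
def coneOn (G : WGraph V E) (A S : Set V) (l : ℝ) (v : V) : Set V :=
  {u | ∃ p : G.Walk v u, (∀ z ∈ p.support, z ∈ A) ∧ Walk.coneCostOn A S p ≤ l}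

end WGraph

/-- Averaging over the threshold: some threshold in `[α, β]` is covered by intervals of small
total weight. -/
theorem exists_threshold_weight_le {ι : Type*} (M : Finset ι) (lo hi c : ι → ℝ) {α β : ℝ}
    (hc : ∀ i ∈ M, 0 ≤ c i) (hle : ∀ i ∈ M, lo i ≤ hi i) (hαβ : α < β) :
    ∃ a, α ≤ a ∧ a ≤ β ∧
      (∑ i ∈ M with lo i < a ∧ a ≤ hi i, c i) * (β - α) ≤ ∑ i ∈ M, c i * (hi i - lo i) := by
  have hint : ∀ i ∈ M, MeasureTheory.IntegrableOn
      (fun a => (Set.Ioc (lo i) (hi i)).indicator (fun _ => c i) a) (Set.Icc α β) := by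
    intro i _
    apply MeasureTheory.Integrable.indicator _ measurableSet_Ioc
    exact MeasureTheory.integrable_const _
  obtain ⟨a, ha, h⟩ := MeasureTheory.exists_le_setAverage (μ := MeasureTheory.volume)
    (s := Set.Icc α β) (f := fun a => ∑ i ∈ M, (Set.Ioc (lo i) (hi i)).indicator (fun _ => c i) a)
    (by simp [hαβ]) (by simp) (MeasureTheory.integrable_finsetSum _ hint)
  refine ⟨a, ha.1, ha.2, ?_⟩
  rw [MeasureTheory.setAverage_eq, MeasureTheory.integral_finsetSum _ hint] at h
  have hlen : MeasureTheory.volume.real (Set.Icc α β) = β - α := by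
    simp [MeasureTheory.measureReal_def, hαβ.le]
  rw [hlen, smul_eq_mul, inv_mul_eq_div, le_div_iff₀ (by linarith)] at h
  have hsum : ∑ i ∈ M, (Set.Ioc (lo i) (hi i)).indicator (fun _ => c i) a =
      ∑ i ∈ M with lo i < a ∧ a ≤ hi i, c i := by
    rw [Finset.sum_filter]
    refine Finset.sum_congr rfl fun i _ => ?_
    simp [Set.indicator_apply]
  rw [← hsum]
  refine h.trans (Finset.sum_le_sum fun i hiM => ?_)
  rw [MeasureTheory.setIntegral_indicator measurableSet_Ioc, MeasureTheory.setIntegral_const,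
    smul_eq_mul, mul_comm]
  refine mul_le_mul_of_nonneg_left ?_ (hc i hiM)
  have := MeasureTheory.measureReal_mono (μ := MeasureTheory.volume)
    (Set.inter_subset_right (s := Set.Icc α β) (t := Set.Ioc (lo i) (hi i))) (by simp)
  refine this.trans ?_
  simp [MeasureTheory.measureReal_def, hle i hiM]

/-- A positive sequence cannot more than double at each of its first `N` steps when its total
growth is less than `2 ^ N`. -/
theorem exists_step_le_two_mul {g : ℕ → ℝ} {N : ℕ} (hg : g N < 2 ^ N * g 0) :
    ∃ i < N, g (i + 1) ≤ 2 * g i := by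
  by_contra! h
  have : ∀ i ≤ N, 2 ^ i * g 0 ≤ g i := by
    intro i
    induction i with
    | zero => simp
    | succ i ih =>
      intro hi
      have := h i (by omega)
      have := ih (by omega)
      rw [pow_succ]; linarith
  linarith [this N le_rfl]

/-- Superadditivity of `x log₂ (x / s)`, with the smaller part charged for the split. -/
theorem mul_logb_superadditive {s a b m : ℝ} (hs : 0 < s) (ha : s ≤ a) (hb : s ≤ b) (hm : 0 ≤ m) :
    a * Real.logb 2 (a / s) + b * Real.logb 2 (b / s) + min a b + m ≤
      (a + b + m) * Real.logb 2 ((a + b + m) / s) := by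
  wlog hab : a ≤ b generalizing a b
  · have := this hb ha (le_of_not_ge hab)
    rw [min_comm, add_comm a b]; linarith
  rw [min_eq_left hab]
  have ha0 : 0 < a := by linarith
  have hb0 : 0 < b := by linarith
  have h1 : 1 + Real.logb 2 (a / s) ≤ Real.logb 2 ((a + b + m) / s) := by
    have : Real.logb 2 (2 * (a / s)) = 1 + Real.logb 2 (a / s) := by
      rw [Real.logb_mul (by norm_num) (by positivity)]; simp
    rw [← this]
    apply Real.logb_le_logb_of_le (by norm_num) (by positivity)
    rw [← mul_div_assoc]; gcongr; linarith
  have h2 : Real.logb 2 (b / s) ≤ Real.logb 2 ((a + b + m) / s) := by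
    apply Real.logb_le_logb_of_le (by norm_num) (by positivity)
    gcongr; linarith
  have h3 : 0 ≤ Real.logb 2 (a / s) := by
    apply Real.logb_nonneg (by norm_num)
    rw [le_div_iff₀ hs]; linarith
  nlinarith

/-- A finite minimax principle: if every weighting of the columns admits a row of small weighted
sum, then some mixture of rows is small in every column. -/
theorem exists_mixture_le {ι κ : Type*} [Fintype ι] [Fintype κ] [Nonempty κ] (A : ι → κ → ℝ)
    (B : ℝ) (h : ∀ μ : κ → ℝ, (∀ e, 0 ≤ μ e) → ∑ e, μ e = 1 → ∃ i, ∑ e, μ e * A i e ≤ B) :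
    ∃ p : ι → ℝ, (∀ i, 0 ≤ p i) ∧ ∑ i, p i = 1 ∧ ∀ e, ∑ i, p i * A i e ≤ B := by
  by_contra! hcon
  let L : (ι → ℝ) →ₗ[ℝ] (κ → ℝ) := ∑ i, (LinearMap.proj i).smulRight (A i)
  have hL : ∀ p e, L p e = ∑ i, p i * A i e := by
    intro p e; simp [L]
  have hLc : Continuous L := L.continuous_of_finiteDimensional
  obtain ⟨f, u, v, hs, huv, ht⟩ := geometric_hahn_banach_compact_closed
    (s := L '' stdSimplex ℝ ι) (t := Set.Iic (fun _ => B))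
    ((convex_stdSimplex ℝ ι).linear_image L) ((isCompact_stdSimplex (𝕜 := ℝ) ι).image hLc)
    (convex_Iic _) isClosed_Iic (by
      rw [Set.disjoint_left]
      rintro _ ⟨p, hp, rfl⟩ hx
      obtain ⟨e, he⟩ := hcon p hp.1 hp.2
      have := hx e
      rw [hL] at this
      exact absurd he (not_lt.2 this))
  let c : κ → ℝ := fun e => f (Pi.single e 1)
  have hf : ∀ x : κ → ℝ, f x = ∑ e, x e * c e := by
    intro x
    conv_lhs => rw [pi_eq_sum_univ' x]
    simp only [map_sum, map_smul, smul_eq_mul, c]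
  have hc : ∀ e, c e ≤ 0 := by
    intro e
    by_contra! hce
    let K : ℝ := max 0 ((f (fun _ => B) - v) / c e)
    have h1 := ht ((fun _ => B) - Pi.single e K) (by
      intro j
      simp only [Pi.sub_apply]
      by_cases hj : j = e
      · subst hj; simp [K]
      · simp [hj])
    rw [map_sub] at h1
    have h2 : f (Pi.single e K) = K * c e := by
      rw [hf]; simp [Pi.single_apply]
    have h3 : (f (fun _ => B) - v) / c e ≤ K := le_max_right _ _
    rw [div_le_iff₀ hce] at h3
    linarith
  have hrow : ∀ i, f (A i) < u := by
    intro i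
    apply hs
    refine ⟨Pi.single i 1, single_mem_stdSimplex ℝ i, ?_⟩
    ext e; rw [hL]; simp [Pi.single_apply]
  have hB := ht (fun _ => B) Set.self_mem_Iic
  let S : ℝ := ∑ e, -c e
  have hS0 : 0 ≤ S := Finset.sum_nonneg fun e _ => by linarith [hc e]
  have hι : ∃ i : ι, True := by
    obtain ⟨i, _⟩ := h (fun _ => 1 / Fintype.card κ) (fun e => by positivity) (by simp)
    exact ⟨i, trivial⟩
  obtain ⟨i₀, -⟩ := hι
  have hS : S ≠ 0 := by
    intro hS
    have hz : ∀ e, c e = 0 := by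
      intro e
      have := (Finset.sum_eq_zero_iff_of_nonneg
        (fun e _ => by linarith [hc e] : ∀ e ∈ Finset.univ, 0 ≤ -c e)).1 hS e (Finset.mem_univ e)
      linarith
    have h1 := hrow i₀
    rw [hf] at h1 hB
    simp [hz] at h1 hB
    linarith
  have hSpos : 0 < S := lt_of_le_of_ne hS0 hS.symm
  obtain ⟨i, hi⟩ := h (fun e => -c e / S) (fun e => div_nonneg (by linarith [hc e]) hS0) (by
    rw [← Finset.sum_div]; exact div_self hS)
  have h1 : ∑ e, -c e / S * A i e = -f (A i) / S := by
    rw [hf, ← Finset.sum_neg_distrib, Finset.sum_div]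
    exact Finset.sum_congr rfl fun e _ => by ring
  have h2 : f (fun _ => B) = -(B * S) := by
    rw [hf]; simp only [S]; rw [Finset.mul_sum, ← Finset.sum_neg_distrib]
    exact Finset.sum_congr rfl fun e _ => by ring
  rw [h1, div_le_iff₀ hSpos] at hi
  linarith [hrow i]

namespace WGraph

variable {V E : Type}

/-- The edge `e` joins `u` and `v`. -/
def Joins (G : WGraph V E) (e : E) (u v : V) : Prop :=
  G.ends e = (u, v) ∨ G.ends e = (v, u)

theorem Joins.symm {G : WGraph V E} {e : E} {u v : V} (h : G.Joins e u v) : G.Joins e v u :=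
  Or.symm h

theorem joins_ends (G : WGraph V E) (e : E) : G.Joins e (G.ends e).1 (G.ends e).2 := Or.inl rfl

theorem len_pos (G : WGraph V E) (e : E) : 0 < G.len e := one_div_pos.2 (G.w_pos e)

/-- `G.Route ℓ F Y u v r`: there is a walk from `u` to `v` inside `Y`, using edges of `F` only,
whose total length with respect to `ℓ` is `r`. -/
inductive Route (G : WGraph V E) (ℓ : E → ℝ) (F : Set E) (Y : Finset V) : V → V → ℝ → Prop
  | nil {u : V} (hu : u ∈ Y) : Route G ℓ F Y u u 0
  | cons {u v x : V} {e : E} {r : ℝ} (hj : G.Joins e u v) (he : e ∈ F) (hu : u ∈ Y)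
      (p : Route G ℓ F Y v x r) : Route G ℓ F Y u x (ℓ e + r)

namespace Route

variable {G : WGraph V E} {ℓ ℓ' : E → ℝ} {F F' : Set E} {Y Z : Finset V} {u v x : V} {r r' : ℝ}

theorem left_mem (p : G.Route ℓ F Y u v r) : u ∈ Y := by cases p <;> assumption

theorem nonneg (hℓ : ∀ e, 0 < ℓ e) (p : G.Route ℓ F Y u v r) : 0 ≤ r := by
  induction p with
  | nil => exact le_rfl
  | cons _ _ _ _ ih => exact add_nonneg (hℓ _).le ih

theorem pos (hℓ : ∀ e, 0 < ℓ e) (huv : u ≠ v) (p : G.Route ℓ F Y u v r) : 0 < r := by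
  cases p with
  | nil => exact absurd rfl huv
  | cons _ _ _ q => exact add_pos_of_pos_of_nonneg (hℓ _) (q.nonneg hℓ)

theorem trans (p : G.Route ℓ F Y u v r) (q : G.Route ℓ F Y v x r') :
    G.Route ℓ F Y u x (r + r') := by
  induction p with
  | nil => simpa using q
  | cons hj he hu _ ih => rw [add_assoc]; exact cons hj he hu (ih q)

theorem single {e : E} (hj : G.Joins e u v) (he : e ∈ F) (hu : u ∈ Y) (hv : v ∈ Y) :
    G.Route ℓ F Y u v (ℓ e) := by
  simpa using cons hj he hu (nil hv) (ℓ := ℓ)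

theorem symm (p : G.Route ℓ F Y u v r) : G.Route ℓ F Y v u r := by
  induction p with
  | nil hu => exact nil hu
  | cons hj he hu q ih => rw [add_comm]; exact ih.trans (single hj.symm he q.left_mem hu)

theorem mono (hF : F ⊆ F') (hY : Y ⊆ Z) (p : G.Route ℓ F Y u v r) : G.Route ℓ F' Z u v r := by
  induction p with
  | nil hu => exact nil (hY hu)
  | cons hj he hu _ ih => exact cons hj (hF he) (hY hu) ih

/-- Shrinking the edge lengths shrinks routes. -/
theorem exists_le (h : ∀ e, ℓ' e ≤ ℓ e) (p : G.Route ℓ F Y u v r) :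
    ∃ r' ≤ r, G.Route ℓ' F Y u v r' := by
  induction p with
  | nil hu => exact ⟨0, le_rfl, nil hu⟩
  | @cons _ _ _ e _ hj he hu _ ih =>
    obtain ⟨r', hr, q⟩ := ih
    exact ⟨_, add_le_add (h e) hr, cons hj he hu q⟩

/-- A function that is `1`-Lipschitz along edges is `1`-Lipschitz along routes. -/
theorem sub_le {f : V → ℝ} (hf : ∀ e a b, a ∈ Y → b ∈ Y → G.Joins e a b → f b - f a ≤ ℓ e)
    (p : G.Route ℓ F Y u v r) : f v - f u ≤ r := by
  induction p with
  | nil => simp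
  | cons hj _ hu q ih => linarith [hf _ _ _ hu q.left_mem hj]

theorem mem_closure (p : G.Route ℓ F Y u v r) : r ∈ AddSubmonoid.closure (Set.range ℓ) := by
  induction p with
  | nil => exact zero_mem _
  | cons _ _ _ _ ih => exact add_mem (AddSubmonoid.subset_closure ⟨_, rfl⟩) ih

/-- The sequence of vertices and edges of a route. -/
theorem exists_seq [Nonempty E] (p : G.Route ℓ F Y u v r) :
    ∃ (k : ℕ) (h : ℕ → V) (b : ℕ → E), h 0 = u ∧ h k = v ∧ (∀ i ≤ k, h i ∈ Y) ∧
      (∀ i < k, G.Joins (b i) (h i) (h (i + 1))) ∧ ∑ i ∈ Finset.range k, ℓ (b i) = r := by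
  induction p with
  | @nil u hu =>
    exact ⟨0, fun _ => u, fun _ => Classical.arbitrary E, rfl, rfl, fun _ _ => hu, by simp, by simp⟩
  | @cons u v x e r hj he hu p ih =>
    obtain ⟨k, h, b, h0, hk, hm, hjn, hs⟩ := ih
    refine ⟨k + 1, fun i => Nat.casesOn i u h, fun i => Nat.casesOn i e b, rfl, hk, ?_, ?_, ?_⟩
    · rintro (_ | i) hi
      · exact hu
      · exact hm i (by omega)
    · rintro (_ | i) hi
      · simpa [h0] using hj
      · exact hjn i (by omega)
    · rw [Finset.sum_range_succ', add_comm, ← hs]; rfl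

end Route

/-- Distance in the subgraph induced on `Y`, with respect to the edge lengths `ℓ`. -/
noncomputable def metric (G : WGraph V E) (ℓ : E → ℝ) (Y : Finset V) (u v : V) : ℝ :=
  sInf {r | G.Route ℓ Set.univ Y u v r}

section Metric

variable {G : WGraph V E} {ℓ ℓ' : E → ℝ} {Y Z : Finset V} {u v x : V} {r : ℝ}

theorem metric_le (hℓ : ∀ e, 0 < ℓ e) (p : G.Route ℓ Set.univ Y u v r) : G.metric ℓ Y u v ≤ r :=
  csInf_le ⟨0, fun _ q => Route.nonneg hℓ q⟩ p

/-- Shortest routes exist. -/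
theorem route_metric [Finite E] (hℓ : ∀ e, 0 < ℓ e) (p : G.Route ℓ Set.univ Y u v r) :
    G.Route ℓ Set.univ Y u v (G.metric ℓ Y u v) := by
  have hpwo : (AddSubmonoid.closure (Set.range ℓ) : Set ℝ).IsPWO :=
    Set.IsPWO.addSubmonoid_closure (by rintro _ ⟨e, rfl⟩; exact (hℓ e).le)
      (Set.finite_range ℓ).isPWO
  have hwf : {r | G.Route ℓ Set.univ Y u v r}.IsWF :=
    hpwo.isWF.mono fun _ q => q.mem_closure
  have hne : {r | G.Route ℓ Set.univ Y u v r}.Nonempty := ⟨r, p⟩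
  have hmin := hwf.min_mem hne
  have : G.metric ℓ Y u v = hwf.min hne :=
    le_antisymm (metric_le hℓ hmin) (le_csInf hne fun _ q => hwf.min_le hne q)
  rw [this]; exact hmin

theorem metric_self (hℓ : ∀ e, 0 < ℓ e) (hu : u ∈ Y) : G.metric ℓ Y u u = 0 :=
  le_antisymm (metric_le hℓ (.nil hu)) (Real.sInf_nonneg fun _ q => Route.nonneg hℓ q)

theorem metric_nonneg (hℓ : ∀ e, 0 < ℓ e) : 0 ≤ G.metric ℓ Y u v :=
  Real.sInf_nonneg fun _ q => Route.nonneg hℓ q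

/-- The subgraph induced on `Y` is connected, phrased via a centre `x₀`. -/
def ConnectedFrom (G : WGraph V E) (ℓ : E → ℝ) (Y : Finset V) (x₀ : V) : Prop :=
  ∀ z ∈ Y, ∃ r, G.Route ℓ Set.univ Y x₀ z r

theorem ConnectedFrom.route [Finite E] {x₀ : V} (hc : G.ConnectedFrom ℓ Y x₀) (hℓ : ∀ e, 0 < ℓ e)
    (hu : u ∈ Y) (hv : v ∈ Y) : G.Route ℓ Set.univ Y u v (G.metric ℓ Y u v) := by
  obtain ⟨r, p⟩ := hc u hu
  obtain ⟨r', q⟩ := hc v hv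
  exact route_metric hℓ (p.symm.trans q)

theorem ConnectedFrom.triangle [Finite E] {x₀ : V} (hc : G.ConnectedFrom ℓ Y x₀)
    (hℓ : ∀ e, 0 < ℓ e) (hu : u ∈ Y) (hv : v ∈ Y) (hx : x ∈ Y) :
    G.metric ℓ Y u x ≤ G.metric ℓ Y u v + G.metric ℓ Y v x :=
  metric_le hℓ ((hc.route hℓ hu hv).trans (hc.route hℓ hv hx))

theorem metric_edge_le (hℓ : ∀ e, 0 < ℓ e) {e : E} (hj : G.Joins e u v) (hu : u ∈ Y) (hv : v ∈ Y) :
    G.metric ℓ Y u v ≤ ℓ e :=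
  metric_le hℓ (.single hj trivial hu hv)

/-- A route survives in any set containing all the vertices through which it could pass. -/
theorem ConnectedFrom.restrict [Finite E] {x₀ : V} (hc : G.ConnectedFrom ℓ Y x₀)
    (hℓ : ∀ e, 0 < ℓ e) (p : G.Route ℓ Set.univ Y u v r)
    (h : ∀ w ∈ Y, G.metric ℓ Y u w + G.metric ℓ Y w v ≤ r → w ∈ Z) :
    G.Route ℓ Set.univ Z u v r := by
  induction p with
  | nil hu => exact .nil (h _ hu (by simp [metric_self hℓ hu]))
  | @cons u v' x e r hj _ hu q ih =>
    refine .cons hj trivial (h u hu ?_) (ih fun w hw hle => h w hw ?_)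
    · rw [metric_self hℓ hu, zero_add]
      exact metric_le hℓ (.cons hj trivial hu q)
    · have := hc.triangle hℓ hu q.left_mem hw
      have := metric_edge_le hℓ hj hu q.left_mem
      linarith

end Metric

end WGraph

namespace WGraph

variable {V E : Type}

/-- A shortest path of the subgraph induced on `Y`, starting at the centre `x₀`, given by its
vertices `h 0, …, h k` and its edges `b 0, …, b (k - 1)`. -/
structure IsHighway (G : WGraph V E) (ℓ : E → ℝ) (Y : Finset V) (x₀ : V) (k : ℕ) (h : ℕ → V)
    (b : ℕ → E) : Prop where
  start : h 0 = x₀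
  mem : ∀ i ≤ k, h i ∈ Y
  joins : ∀ i < k, G.Joins (b i) (h i) (h (i + 1))
  grow : ∀ i < k, G.metric ℓ Y x₀ (h (i + 1)) = G.metric ℓ Y x₀ (h i) + ℓ (b i)

/-- The potential whose superlevel sets are the petals around the highway `h`. -/
noncomputable def petalPotential (G : WGraph V E) (ℓ : E → ℝ) (Y : Finset V) (x₀ : V) (k : ℕ)
    (h : ℕ → V) (z : V) : ℝ :=
  (Finset.range (k + 1)).sup' Finset.nonempty_range_add_one fun i =>
    2 * G.metric ℓ Y x₀ z - G.metric ℓ Y x₀ (h i) - 2 * G.metric ℓ Y (h i) z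

variable {G : WGraph V E} {ℓ ℓ' : E → ℝ} {Y X : Finset V} {x₀ : V} {k : ℕ} {h : ℕ → V}
  {b : ℕ → E}

theorem exists_highway [Finite E] [Nonempty E] (hℓ : ∀ e, 0 < ℓ e) (hc : G.ConnectedFrom ℓ Y x₀)
    {p : V} (hp : p ∈ Y) : ∃ k h b, G.IsHighway ℓ Y x₀ k h b ∧ h k = p := by
  obtain ⟨r, q⟩ := hc p hp
  have hx := q.left_mem
  obtain ⟨k, h, b, h0, hk, hm, hj, hs⟩ := (hc.route hℓ hx hp).exists_seq
  refine ⟨k, h, b, ⟨h0, hm, hj, ?_⟩, hk⟩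
  have hle : ∀ i ∈ Finset.range k,
      G.metric ℓ Y x₀ (h (i + 1)) - G.metric ℓ Y x₀ (h i) ≤ ℓ (b i) := by
    intro i hi
    have hi := Finset.mem_range.1 hi
    have := hc.triangle hℓ hx (hm i (by omega)) (hm (i + 1) (by omega))
    have := metric_edge_le hℓ (hj i hi) (hm i (by omega)) (hm (i + 1) (by omega))
    linarith
  have htel := Finset.sum_range_sub (fun i => G.metric ℓ Y x₀ (h i)) k
  rw [hk, h0, metric_self hℓ hx, sub_zero, ← hs] at htel
  intro i hi
  have := (Finset.sum_eq_sum_iff_of_le hle).1 htel i (Finset.mem_range.2 hi)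
  linarith

namespace IsHighway

theorem center_mem (H : G.IsHighway ℓ Y x₀ k h b) : x₀ ∈ Y := H.start ▸ H.mem 0 (Nat.zero_le _)

theorem metric_mono (H : G.IsHighway ℓ Y x₀ k h b) (hℓ : ∀ e, 0 < ℓ e) {i j : ℕ} (hij : i ≤ j)
    (hj : j ≤ k) : G.metric ℓ Y x₀ (h i) ≤ G.metric ℓ Y x₀ (h j) := by
  induction j, hij using Nat.le_induction with
  | base => exact le_rfl
  | succ j _ ih =>
    rw [H.grow j hj]
    linarith [ih (by omega), hℓ (b j)]

/-- The place where the distance from the centre along a highway first reaches `a`. -/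
theorem exists_first (H : G.IsHighway ℓ Y x₀ k h b) (hℓ : ∀ e, 0 < ℓ e) {a : ℝ} (ha : 0 < a)
    (hk : a ≤ G.metric ℓ Y x₀ (h k)) :
    ∃ m < k, (∀ i ≤ m, G.metric ℓ Y x₀ (h i) < a) ∧
      ∀ i, m < i → i ≤ k → a ≤ G.metric ℓ Y x₀ (h i) := by
  have hex : ∃ i, a ≤ G.metric ℓ Y x₀ (h i) := ⟨k, hk⟩
  have h0 : Nat.find hex ≠ 0 := by
    intro h0
    have := Nat.find_spec hex
    rw [h0, H.start, metric_self hℓ H.center_mem] at this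
    linarith
  have hle := Nat.find_min' hex hk
  refine ⟨Nat.find hex - 1, by omega, fun i hi => not_le.1 (Nat.find_min hex (by omega)), ?_⟩
  intro i hi hik
  exact (Nat.find_spec hex).trans (H.metric_mono hℓ (by omega) hik)

theorem le_petalPotential {i : ℕ} (hi : i ≤ k) (z : V) :
    2 * G.metric ℓ Y x₀ z - G.metric ℓ Y x₀ (h i) - 2 * G.metric ℓ Y (h i) z ≤
      G.petalPotential ℓ Y x₀ k h z :=
  Finset.le_sup' (fun i => 2 * G.metric ℓ Y x₀ z - G.metric ℓ Y x₀ (h i) -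
    2 * G.metric ℓ Y (h i) z) (Finset.mem_range.2 (by omega))

theorem exists_eq_petalPotential (z : V) : ∃ i ≤ k, G.petalPotential ℓ Y x₀ k h z =
    2 * G.metric ℓ Y x₀ z - G.metric ℓ Y x₀ (h i) - 2 * G.metric ℓ Y (h i) z := by
  obtain ⟨i, hi, he⟩ := Finset.exists_mem_eq_sup' (Finset.nonempty_range_add_one (n := k))
    fun i => 2 * G.metric ℓ Y x₀ z - G.metric ℓ Y x₀ (h i) - 2 * G.metric ℓ Y (h i) z
  exact ⟨i, by have := Finset.mem_range.1 hi; omega, he⟩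

theorem petalPotential_le [Finite E] (H : G.IsHighway ℓ Y x₀ k h b) (hℓ : ∀ e, 0 < ℓ e)
    (hc : G.ConnectedFrom ℓ Y x₀) {z : V} (hz : z ∈ Y) :
    G.petalPotential ℓ Y x₀ k h z ≤ G.metric ℓ Y x₀ z := by
  obtain ⟨i, hi, he⟩ := exists_eq_petalPotential (G := G) (ℓ := ℓ) (Y := Y) (x₀ := x₀) (k := k)
    (h := h) z
  have := hc.triangle hℓ H.center_mem (H.mem i hi) hz
  have := metric_nonneg (G := G) (Y := Y) (u := h i) (v := z) hℓ
  linarith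

theorem petalPotential_highway [Finite E] (H : G.IsHighway ℓ Y x₀ k h b) (hℓ : ∀ e, 0 < ℓ e)
    (hc : G.ConnectedFrom ℓ Y x₀) {i : ℕ} (hi : i ≤ k) :
    G.petalPotential ℓ Y x₀ k h (h i) = G.metric ℓ Y x₀ (h i) := by
  refine le_antisymm (H.petalPotential_le hℓ hc (H.mem i hi)) ?_
  have := le_petalPotential (G := G) (ℓ := ℓ) (Y := Y) (x₀ := x₀) (h := h) hi (h i)
  rw [metric_self hℓ (H.mem i hi)] at this
  linarith

theorem petalPotential_sub_le [Finite E] (H : G.IsHighway ℓ Y x₀ k h b) (hℓ : ∀ e, 0 < ℓ e)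
    (hc : G.ConnectedFrom ℓ Y x₀) {e : E} {u v : V} (hu : u ∈ Y) (hv : v ∈ Y)
    (hj : G.Joins e u v) :
    G.petalPotential ℓ Y x₀ k h v - G.petalPotential ℓ Y x₀ k h u ≤ 4 * ℓ e := by
  obtain ⟨i, hi, he⟩ := exists_eq_petalPotential (G := G) (ℓ := ℓ) (Y := Y) (x₀ := x₀) (k := k)
    (h := h) v
  have h1 := le_petalPotential (G := G) (ℓ := ℓ) (Y := Y) (x₀ := x₀) (h := h) hi u
  have h2 := hc.triangle hℓ H.center_mem hu hv
  have h3 := hc.triangle hℓ (H.mem i hi) hv hu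
  have h4 := metric_edge_le hℓ hj hu hv
  have h5 := metric_edge_le hℓ hj.symm hv hu
  linarith

/-- Shortest routes from the centre to vertices outside the petal avoid the petal. -/
theorem remainder_route [Finite E] (H : G.IsHighway ℓ Y x₀ k h b) (hℓ : ∀ e, 0 < ℓ e)
    (hc : G.ConnectedFrom ℓ Y x₀) {a : ℝ} {z : V}
    (hz : z ∈ Y.filter (G.petalPotential ℓ Y x₀ k h · < a)) :
    G.Route ℓ Set.univ (Y.filter (G.petalPotential ℓ Y x₀ k h · < a)) x₀ z
      (G.metric ℓ Y x₀ z) := by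
  obtain ⟨hzY, hza⟩ := Finset.mem_filter.1 hz
  refine hc.restrict hℓ (hc.route hℓ H.center_mem hzY) fun w hw hle =>
    Finset.mem_filter.2 ⟨hw, ?_⟩
  obtain ⟨i, hi, he⟩ := exists_eq_petalPotential (G := G) (ℓ := ℓ) (Y := Y) (x₀ := x₀) (k := k)
    (h := h) w
  have h1 := le_petalPotential (G := G) (ℓ := ℓ) (Y := Y) (x₀ := x₀) (h := h) hi z
  have h2 := hc.triangle hℓ (H.mem i hi) hw hzY
  linarith

/-- Every vertex of the petal is close to a highway vertex of the petal, within the petal. -/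
theorem petal_route [Finite E] (H : G.IsHighway ℓ Y x₀ k h b) (hℓ : ∀ e, 0 < ℓ e)
    (hc : G.ConnectedFrom ℓ Y x₀) {a : ℝ} {z : V}
    (hz : z ∈ Y.filter (a ≤ G.petalPotential ℓ Y x₀ k h ·)) :
    ∃ i ≤ k, a ≤ G.metric ℓ Y x₀ (h i) ∧ ∃ r,
      G.Route ℓ Set.univ (Y.filter (a ≤ G.petalPotential ℓ Y x₀ k h ·)) (h i) z r ∧
      r ≤ G.metric ℓ Y x₀ z - (G.metric ℓ Y x₀ (h i) + a) / 2 := by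
  obtain ⟨hzY, hza⟩ := Finset.mem_filter.1 hz
  obtain ⟨i, hi, he⟩ := exists_eq_petalPotential (G := G) (ℓ := ℓ) (Y := Y) (x₀ := x₀) (k := k)
    (h := h) z
  have h1 := hc.triangle hℓ H.center_mem (H.mem i hi) hzY
  refine ⟨i, hi, by linarith, _, hc.restrict hℓ (hc.route hℓ (H.mem i hi) hzY) fun w hw hle =>
    Finset.mem_filter.2 ⟨hw, ?_⟩, by linarith⟩
  have h2 := le_petalPotential (G := G) (ℓ := ℓ) (Y := Y) (x₀ := x₀) (h := h) hi w
  have h3 := hc.triangle hℓ H.center_mem hw hzY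
  linarith

theorem truncate (H : G.IsHighway ℓ Y x₀ k h b) {Z : Finset V} {m : ℕ} (hm : m ≤ k)
    (hmem : ∀ i ≤ m, h i ∈ Z) (hmet : ∀ z ∈ Z, G.metric ℓ Z x₀ z = G.metric ℓ Y x₀ z) :
    G.IsHighway ℓ Z x₀ m h b :=
  ⟨H.start, hmem, fun i hi => H.joins i (by omega), fun i hi => by
    rw [hmet _ (hmem _ (by omega)), hmet _ (hmem _ (by omega)), H.grow i (by omega)]⟩

/-- The far end of a highway, with lengths scaled by `c`, is a highway of a set whose edge
lengths shrink by at most `c`. -/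
theorem drop [Finite E] (H : G.IsHighway ℓ Y x₀ k h b) (hℓ : ∀ e, 0 < ℓ e)
    (hc : G.ConnectedFrom ℓ Y x₀) (hℓ' : ∀ e, 0 < ℓ' e) {c : ℝ} (hc0 : 0 < c) {m : ℕ} (hm : m ≤ k)
    (hX : X ⊆ Y) (hmem : ∀ i, m ≤ i → i ≤ k → h i ∈ X) (hle : ∀ e, c * ℓ e ≤ ℓ' e)
    (heq : ∀ i, m ≤ i → i < k → ℓ' (b i) = c * ℓ (b i)) :
    (∀ j, j ≤ k - m → G.Route ℓ' Set.univ X (h m) (h (m + j))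
      (c * (G.metric ℓ Y x₀ (h (m + j)) - G.metric ℓ Y x₀ (h m)))) ∧
    (∀ j, j ≤ k - m → G.metric ℓ' X (h m) (h (m + j)) =
      c * (G.metric ℓ Y x₀ (h (m + j)) - G.metric ℓ Y x₀ (h m))) ∧
    G.IsHighway ℓ' X (h m) (k - m) (fun j => h (m + j)) (fun j => b (m + j)) := by
  have hroute : ∀ j, j ≤ k - m → G.Route ℓ' Set.univ X (h m) (h (m + j))
      (c * (G.metric ℓ Y x₀ (h (m + j)) - G.metric ℓ Y x₀ (h m))) := by
    intro j
    induction j with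
    | zero => intro _; simpa using Route.nil (hmem m le_rfl hm)
    | succ j ih =>
      intro hj
      have := (ih (by omega)).trans (Route.single (F := Set.univ) (ℓ := ℓ')
        (H.joins (m + j) (by omega)) trivial
        (hmem _ (by omega) (by omega)) (hmem _ (by omega) (by omega)))
      rw [heq _ (by omega) (by omega)] at this
      rw [← add_assoc, H.grow (m + j) (by omega)]
      convert this using 1
      ring
  have hmet : ∀ j, j ≤ k - m → G.metric ℓ' X (h m) (h (m + j)) =
      c * (G.metric ℓ Y x₀ (h (m + j)) - G.metric ℓ Y x₀ (h m)) := by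
    intro j hj
    refine le_antisymm (metric_le hℓ' (hroute j hj)) ?_
    have := (route_metric hℓ' (hroute j hj)).sub_le (f := fun v => c * G.metric ℓ Y x₀ v) (by
      intro e u v hu hv hjn
      have h1 := hc.triangle hℓ H.center_mem (hX hu) (hX hv)
      have h2 := metric_edge_le hℓ hjn (hX hu) (hX hv)
      nlinarith [hle e])
    linarith
  refine ⟨hroute, hmet, rfl, fun j hj => hmem _ (by omega) (by omega),
    fun j hj => H.joins (m + j) (by omega), fun j hj => ?_⟩
  have h1 := hmet (j + 1) (by omega)
  rw [hmet j (by omega), heq _ (by omega) (by omega)]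
  rw [h1, ← add_assoc, H.grow (m + j) (by omega)]
  ring

end IsHighway

end WGraph

namespace WGraph

variable {V E : Type} [Fintype E]

/-- The edges with both ends in `Y`. -/
noncomputable def inner (G : WGraph V E) (Y : Finset V) : Finset E :=
  Finset.univ.filter fun e => (G.ends e).1 ∈ Y ∧ (G.ends e).2 ∈ Y

/-- The mass `μ` of the edges inside `Y`, plus `s` for each vertex of `Y`. -/
noncomputable def vol (G : WGraph V E) (μ : E → ℝ) (s : ℝ) (Y : Finset V) : ℝ :=
  ∑ e ∈ G.inner Y, μ e + s * Y.card

/-- The edges inside `Y` that are cut by the level `a` of `φ`. -/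
noncomputable def levelCut (G : WGraph V E) (Y : Finset V) (φ : V → ℝ) (a : ℝ) : Finset E :=
  (G.inner Y).filter fun e =>
    e ∉ G.inner (Y.filter (a ≤ φ ·)) ∧ e ∉ G.inner (Y.filter (φ · < a))

variable {G : WGraph V E} {μ : E → ℝ} {s : ℝ} {Y Z : Finset V} {φ : V → ℝ} {a : ℝ}

theorem mem_inner {e : E} : e ∈ G.inner Y ↔ (G.ends e).1 ∈ Y ∧ (G.ends e).2 ∈ Y := by
  simp [inner]

theorem inner_mono (h : Y ⊆ Z) : G.inner Y ⊆ G.inner Z := fun e he => by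
  rw [mem_inner] at he ⊢; exact ⟨h he.1, h he.2⟩

theorem vol_mono (hμ : ∀ e, 0 ≤ μ e) (hs : 0 ≤ s) (h : Y ⊆ Z) : G.vol μ s Y ≤ G.vol μ s Z := by
  unfold vol
  have := Finset.sum_le_sum_of_subset_of_nonneg (inner_mono (G := G) h) fun e _ _ => hμ e
  gcongr

theorem le_vol (hμ : ∀ e, 0 ≤ μ e) (hs : 0 ≤ s) (h : Y.Nonempty) : s ≤ G.vol μ s Y := by
  unfold vol
  have h1 := Finset.sum_nonneg fun e (_ : e ∈ G.inner Y) => hμ e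
  have h2 : (1 : ℝ) ≤ Y.card := by exact_mod_cast h.card_pos
  nlinarith

theorem sum_inner_split (f : E → ℝ) : ∑ e ∈ G.inner Y, f e =
    ∑ e ∈ G.inner (Y.filter (a ≤ φ ·)), f e + ∑ e ∈ G.inner (Y.filter (φ · < a)), f e +
      ∑ e ∈ G.levelCut Y φ a, f e := by
  have hd : Disjoint (G.inner (Y.filter (a ≤ φ ·))) (G.inner (Y.filter (φ · < a))) := by
    rw [Finset.disjoint_left]
    intro e h1 h2
    rw [mem_inner] at h1 h2
    simp only [Finset.mem_filter] at h1 h2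
    linarith [h1.1.2, h2.1.2]
  have hsub : G.inner (Y.filter (a ≤ φ ·)) ∪ G.inner (Y.filter (φ · < a)) ⊆ G.inner Y :=
    Finset.union_subset (inner_mono (Finset.filter_subset _ _))
      (inner_mono (Finset.filter_subset _ _))
  rw [← Finset.sum_union hd, ← Finset.sum_sdiff hsub, add_comm]
  congr 2
  ext e
  simp [levelCut]

theorem vol_split : G.vol μ s Y = G.vol μ s (Y.filter (a ≤ φ ·)) + G.vol μ s (Y.filter (φ · < a)) +
    ∑ e ∈ G.levelCut Y φ a, μ e := by
  unfold vol
  rw [sum_inner_split (φ := φ) (a := a) μ]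
  have := Finset.card_filter_add_card_filter_not (s := Y) (a ≤ φ ·)
  simp only [not_le] at this
  rw [← this]; push_cast; ring

theorem mem_levelCut {e : E} : e ∈ G.levelCut Y φ a ↔ e ∈ G.inner Y ∧
    min (φ (G.ends e).1) (φ (G.ends e).2) < a ∧ a ≤ max (φ (G.ends e).1) (φ (G.ends e).2) := by
  simp only [levelCut, Finset.mem_filter, mem_inner, min_lt_iff, le_max_iff]
  constructor
  · rintro ⟨⟨h1, h2⟩, h3, h4⟩
    refine ⟨⟨h1, h2⟩, ?_⟩
    by_contra hcon
    grind
  · rintro ⟨⟨h1, h2⟩, h3, h4⟩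
    grind

/-- Region growing from both sides: some level in an interval of width `r / 4` cuts little, in
comparison with the smaller of the two sides. -/
theorem exists_levelCut_le (hμ : ∀ e, 0 ≤ μ e) (hs : 0 < s) {N : ℕ} {r α : ℝ} (hr : 0 < r)
    (hN : (G.vol μ s Y / s) ^ 2 < 2 ^ N)
    (hφ : ∀ e u v, u ∈ Y → v ∈ Y → G.Joins e u v → φ v - φ u ≤ 4 * G.len e)
    (htop : ∃ p ∈ Y, α + r / 4 ≤ φ p) (hbot : ∃ x ∈ Y, φ x < α) :
    ∃ a, α ≤ a ∧ a ≤ α + r / 4 ∧ ∑ e ∈ G.levelCut Y φ a, μ e / G.len e ≤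
      96 * N / r * (min (G.vol μ s (Y.filter (a ≤ φ ·))) (G.vol μ s (Y.filter (φ · < a))) +
        ∑ e ∈ G.levelCut Y φ a, μ e) := by
  obtain ⟨p, hpY, hp⟩ := htop
  obtain ⟨x, hxY, hx⟩ := hbot
  have hV : s ≤ G.vol μ s Y := le_vol hμ hs.le ⟨p, hpY⟩
  have hV0 : 0 < G.vol μ s Y := by linarith
  have hN0 : N ≠ 0 := by
    rintro rfl
    have h1 : 1 ≤ G.vol μ s Y / s := by rwa [one_le_div hs]
    have := one_le_pow₀ h1 (n := 2)
    rw [pow_zero] at hN; linarith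
  have hN1 : (0 : ℝ) < N := by positivity
  set w : ℝ := r / 4 / N with hw
  have hw0 : 0 < w := by positivity
  have hwN : N * w = r / 4 := by rw [hw]; field_simp
  let t : ℕ → ℝ := fun i => α + i * w
  let A : ℝ → ℝ := fun a => G.vol μ s (Y.filter (a ≤ φ ·))
  let B : ℝ → ℝ := fun a => G.vol μ s (Y.filter (φ · < a))
  have hA : ∀ a a', a ≤ a' → A a' ≤ A a := fun a a' haa =>
    vol_mono hμ hs.le fun z hz => by
      simp only [Finset.mem_filter] at hz ⊢; exact ⟨hz.1, haa.trans hz.2⟩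
  have hB : ∀ a a', a ≤ a' → B a ≤ B a' := fun a a' haa =>
    vol_mono hμ hs.le fun z hz => by
      simp only [Finset.mem_filter] at hz ⊢; exact ⟨hz.1, hz.2.trans_le haa⟩
  have hAs : ∀ a ≤ α + r / 4, s ≤ A a := fun a ha =>
    le_vol hμ hs.le ⟨p, by simp only [Finset.mem_filter]; exact ⟨hpY, ha.trans hp⟩⟩
  have hBs : ∀ a, α ≤ a → s ≤ B a := fun a ha =>
    le_vol hμ hs.le ⟨x, by simp only [Finset.mem_filter]; exact ⟨hxY, hx.trans_le ha⟩⟩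
  have hAV : ∀ a, A a ≤ G.vol μ s Y := fun a => vol_mono hμ hs.le (Finset.filter_subset _ _)
  have hBV : ∀ a, B a ≤ G.vol μ s Y := fun a => vol_mono hμ hs.le (Finset.filter_subset _ _)
  have htN : t N = α + r / 4 := by simp only [t]; rw [hwN]
  have ht0 : t 0 = α := by simp [t]
  have hstep : ∃ i < N, B (t (i + 1)) / A (t (i + 1)) ≤ 2 * (B (t i) / A (t i)) := by
    refine exists_step_le_two_mul (g := fun i => B (t i) / A (t i)) ?_
    simp only [htN, ht0]
    have h1 : B (α + r / 4) / A (α + r / 4) ≤ G.vol μ s Y / s :=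
      div_le_div₀ hV0.le (hBV _) hs (hAs _ le_rfl)
    have h2 : s / G.vol μ s Y ≤ B α / A α :=
      div_le_div₀ (hs.le.trans (hBs _ le_rfl)) (hBs _ le_rfl)
        (hs.trans_le (hAs _ (by linarith))) (hAV _)
    have h3 : G.vol μ s Y / s = (G.vol μ s Y / s) ^ 2 * (s / G.vol μ s Y) := by
      field_simp
    calc _ ≤ _ := h1
      _ = _ := h3
      _ < 2 ^ N * (s / G.vol μ s Y) := by gcongr
      _ ≤ _ := by gcongr
  obtain ⟨i, hiN, hi⟩ := hstep
  have hti : t (i + 1) = t i + w := by simp only [t]; push_cast; ring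
  have hti0 : α ≤ t i := by simp only [t]; nlinarith [(Nat.cast_nonneg i : (0 : ℝ) ≤ i)]
  have hti1 : t (i + 1) ≤ α + r / 4 := by
    rw [← hwN]; simp only [t]
    have : ((i + 1 : ℕ) : ℝ) ≤ N := by exact_mod_cast hiN
    nlinarith
  have hA1 : 0 < A (t (i + 1)) := hs.trans_le (hAs _ hti1)
  have hA0 : A (t (i + 1)) ≤ A (t i) := hA _ _ (by linarith)
  have hB1 : 0 < B (t i) := hs.trans_le (hBs _ hti0)
  have hB0 : B (t i) ≤ B (t (i + 1)) := hB _ _ (by linarith)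
  rw [← mul_div_assoc, div_le_div_iff₀ hA1 (by linarith)] at hi
  have hBd : B (t (i + 1)) ≤ 2 * B (t i) := by
    by_contra! hcon
    nlinarith
  have hAd : A (t i) ≤ 2 * A (t (i + 1)) := by
    by_contra! hcon
    nlinarith
  let lo : E → ℝ := fun e => min (φ (G.ends e).1) (φ (G.ends e).2)
  let hi' : E → ℝ := fun e => max (φ (G.ends e).1) (φ (G.ends e).2)
  have hlohi : ∀ e, lo e ≤ hi' e := fun e => min_le_max
  have hlip : ∀ e ∈ G.inner Y, hi' e - lo e ≤ 4 * G.len e := by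
    intro e he
    rw [mem_inner] at he
    have h1 := hφ e _ _ he.1 he.2 (G.joins_ends e)
    have h2 := hφ e _ _ he.2 he.1 (G.joins_ends e).symm
    simp only [hi', lo]
    rcases le_total (φ (G.ends e).1) (φ (G.ends e).2) with h | h <;> simp [h] <;> linarith
  let M : Finset E := (G.inner Y).filter fun e => t i ≤ lo e ∧ hi' e < t (i + 1)
  obtain ⟨a, ha1, ha2, ha⟩ := exists_threshold_weight_le M lo hi' (fun e => μ e / G.len e)
    (α := t i + w / 3) (β := t i + 2 * w / 3) (fun e _ => div_nonneg (hμ e) (G.len_pos e).le)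
    (fun e _ => hlohi e) (by linarith)
  have hMA : ∑ e ∈ M, μ e ≤ 2 * A a := by
    have h1 : ∑ e ∈ M, μ e ≤ A (t i) := by
      have : ∑ e ∈ M, μ e ≤ ∑ e ∈ G.inner (Y.filter (t i ≤ φ ·)), μ e := by
        refine Finset.sum_le_sum_of_subset_of_nonneg (fun e he => ?_) fun e _ _ => hμ e
        simp only [M, lo, Finset.mem_filter, mem_inner, le_min_iff] at he ⊢
        tauto
      have h0 : 0 ≤ s * ((Y.filter (t i ≤ φ ·)).card : ℝ) := by positivity
      simp only [A, vol]; linarith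
    linarith [hA a (t (i + 1)) (by linarith)]
  have hMB : ∑ e ∈ M, μ e ≤ 2 * B a := by
    have h1 : ∑ e ∈ M, μ e ≤ B (t (i + 1)) := by
      have : ∑ e ∈ M, μ e ≤ ∑ e ∈ G.inner (Y.filter (φ · < t (i + 1))), μ e := by
        refine Finset.sum_le_sum_of_subset_of_nonneg (fun e he => ?_) fun e _ _ => hμ e
        simp only [M, hi', Finset.mem_filter, mem_inner, max_lt_iff] at he ⊢
        tauto
      have h0 : 0 ≤ s * ((Y.filter (φ · < t (i + 1))).card : ℝ) := by positivity
      simp only [B, vol]; linarith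
    linarith [hB (t i) a (by linarith)]
  have hM4 : ∑ e ∈ M, μ e / G.len e * (hi' e - lo e) ≤ 4 * ∑ e ∈ M, μ e := by
    rw [Finset.mul_sum]
    refine Finset.sum_le_sum fun e he => ?_
    have h1 := hlip e (Finset.mem_filter.1 he).1
    have h2 := G.len_pos e
    calc _ ≤ μ e / G.len e * (4 * G.len e) := by
          gcongr; exact div_nonneg (hμ e) h2.le
      _ = _ := by field_simp
  have hshort : ∑ e ∈ (G.levelCut Y φ a).filter (fun e => 12 * G.len e < w), μ e / G.len e ≤
      24 / w * min (A a) (B a) := by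
    have h1 : ∑ e ∈ (G.levelCut Y φ a).filter (fun e => 12 * G.len e < w), μ e / G.len e ≤
        ∑ e ∈ M with lo e < a ∧ a ≤ hi' e, μ e / G.len e := by
      refine Finset.sum_le_sum_of_subset_of_nonneg (fun e he => ?_)
        fun e _ _ => div_nonneg (hμ e) (G.len_pos e).le
      rw [Finset.mem_filter, mem_levelCut] at he
      have := hlip e he.1.1
      have h3 : lo e < a := he.1.2.1
      have h4 : a ≤ hi' e := he.1.2.2
      refine Finset.mem_filter.2 ⟨Finset.mem_filter.2 ⟨he.1.1, ?_, ?_⟩, h3, h4⟩ <;> linarith [he.2]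
    have h2 : ∑ e ∈ M, μ e ≤ 2 * min (A a) (B a) := by
      rw [mul_min_of_nonneg _ _ (by norm_num : (0 : ℝ) ≤ 2)]; exact le_min hMA hMB
    refine h1.trans ?_
    rw [div_mul_eq_mul_div, le_div_iff₀ hw0]
    have h5 : t i + 2 * w / 3 - (t i + w / 3) = w / 3 := by ring
    rw [h5] at ha
    linarith
  have hlong : ∑ e ∈ (G.levelCut Y φ a).filter (fun e => ¬ 12 * G.len e < w), μ e / G.len e ≤
      24 / w * ∑ e ∈ G.levelCut Y φ a, μ e := by
    calc _ ≤ ∑ e ∈ (G.levelCut Y φ a).filter (fun e => ¬ 12 * G.len e < w), 24 / w * μ e := by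
          refine Finset.sum_le_sum fun e he => ?_
          have h1 := not_lt.1 (Finset.mem_filter.1 he).2
          have h2 := G.len_pos e
          rw [div_mul_eq_mul_div, div_le_div_iff₀ h2 hw0]
          nlinarith [hμ e]
      _ ≤ ∑ e ∈ G.levelCut Y φ a, 24 / w * μ e := by
          refine Finset.sum_le_sum_of_subset_of_nonneg (Finset.filter_subset _ _) fun e _ _ => ?_
          have := hμ e; positivity
      _ = _ := by rw [Finset.mul_sum]
  have hconst : 96 * (N : ℝ) / r = 24 / w := by rw [hw]; field_simp; norm_num
  refine ⟨a, by linarith, by linarith, ?_⟩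
  rw [hconst, mul_add,
    ← Finset.sum_filter_add_sum_filter_not (G.levelCut Y φ a) (fun e => 12 * G.len e < w)]
  exact add_le_add hshort hlong

end WGraph

namespace WGraph

variable {V E : Type}

/-- The data handled by one step of the petal decomposition: a cluster `Y` with centre `x₀`, a
highway `h`, and edge lengths `ℓ` obtained by shrinking edges of the highway. -/
structure IsCluster (G : WGraph V E) (ℓ : E → ℝ) (Y : Finset V) (x₀ : V) (k : ℕ) (h : ℕ → V)
    (b : ℕ → E) : Prop where
  connected : G.ConnectedFrom ℓ Y x₀
  len_le : ∀ e, G.len e ≤ 2 * ℓ e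
  le_len : ∀ e, ℓ e ≤ G.len e
  eq_len : ∀ e u v, u ∈ Y → v ∈ Y → G.Joins e u v → (∀ i ≤ k, h i ≠ u) → ℓ e = G.len e
  highway : G.IsHighway ℓ Y x₀ k h b

variable {G : WGraph V E} {μ : E → ℝ} {s : ℝ} {N : ℕ} {ℓ ℓ' : E → ℝ} {Y : Finset V} {x₀ : V}
  {k : ℕ} {h : ℕ → V} {b : ℕ → E}

theorem IsCluster.pos (C : G.IsCluster ℓ Y x₀ k h b) (e : E) : 0 < ℓ e := by
  linarith [C.len_le e, G.len_pos e]

variable [Fintype E]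

/-- `T` is the edge set of a tree spanning `Y`, and `S` bounds the stretch of the edges inside `Y`,
with a small `μ`-average. -/
structure IsLowStretchTree (G : WGraph V E) (μ : E → ℝ) (s : ℝ) (N : ℕ) (Y : Finset V)
    (T : Finset E) (S : E → ℝ) : Prop where
  subset : T ⊆ G.inner Y
  card : T.card + 1 = Y.card
  route : ∀ e ∈ G.inner Y, ∃ ρ ≤ S e * G.len e, G.Route G.len T Y (G.ends e).1 (G.ends e).2 ρ
  sum_le : ∑ e ∈ G.inner Y, μ e * S e ≤ 768 * N * (G.vol μ s Y * Real.logb 2 (G.vol μ s Y / s))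

/-- A low stretch tree that approximates distances from `x₀`, especially well on the highway. -/
def HasLowStretchTree (G : WGraph V E) (μ : E → ℝ) (s : ℝ) (N : ℕ) (ℓ : E → ℝ) (Y : Finset V)
    (x₀ : V) (k : ℕ) (h : ℕ → V) : Prop :=
  ∃ T S, G.IsLowStretchTree μ s N Y T S ∧
    (∀ z ∈ Y, ∃ ρ ≤ 4 * G.metric ℓ Y x₀ z, G.Route G.len T Y x₀ z ρ) ∧
    ∀ i ≤ k, ∃ ρ ≤ 2 * G.metric ℓ Y x₀ (h i), G.Route G.len T Y x₀ (h i) ρ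

/-- Two low stretch trees, on the two sides of a sparse level cut, joined by a bridge. -/
theorem IsLowStretchTree.glue {φ : V → ℝ} {a r : ℝ} {TX TZ : Finset E} {SX SZ : E → ℝ} {e₀ : E}
    {x y : V} (hμ : ∀ e, 0 ≤ μ e) (hs : 0 < s) (hr : 0 < r)
    (hcut : ∑ e ∈ G.levelCut Y φ a, μ e / G.len e ≤
      96 * N / r * (min (G.vol μ s (Y.filter (a ≤ φ ·))) (G.vol μ s (Y.filter (φ · < a))) +
        ∑ e ∈ G.levelCut Y φ a, μ e))
    (hX : G.IsLowStretchTree μ s N (Y.filter (a ≤ φ ·)) TX SX)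
    (hZ : G.IsLowStretchTree μ s N (Y.filter (φ · < a)) TZ SZ)
    (hx : x ∈ Y.filter (a ≤ φ ·)) (hy : y ∈ Y.filter (φ · < a)) (hj : G.Joins e₀ y x)
    (hroute : ∀ z ∈ Y, ∃ ρ ≤ 4 * r,
      G.Route G.len (insert e₀ (TX ∪ TZ) : Finset E) Y x₀ z ρ) :
    ∃ S, G.IsLowStretchTree μ s N Y (insert e₀ (TX ∪ TZ)) S := by
  set X := Y.filter (a ≤ φ ·) with hXd
  set Z := Y.filter (φ · < a) with hZd
  have hXY : X ⊆ Y := Finset.filter_subset _ _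
  have hZY : Z ⊆ Y := Finset.filter_subset _ _
  have hdisj : ∀ v, v ∈ X → v ∉ Z := by
    intro v h1 h2
    simp only [hXd, hZd, Finset.mem_filter] at h1 h2
    linarith [h1.2, h2.2]
  have heX : e₀ ∉ G.inner X := by
    rw [mem_inner]
    rcases hj with h | h <;> rw [h]
    · exact fun h' => hdisj _ h'.1 hy
    · exact fun h' => hdisj _ h'.2 hy
  have heZ : e₀ ∉ G.inner Z := by
    rw [mem_inner]
    rcases hj with h | h <;> rw [h]
    · exact fun h' => hdisj _ hx h'.2
    · exact fun h' => hdisj _ hx h'.1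
  have heY : e₀ ∈ G.inner Y := by
    rw [mem_inner]
    rcases hj with h | h <;> rw [h]
    exacts [⟨hZY hy, hXY hx⟩, ⟨hXY hx, hZY hy⟩]
  have hTd : Disjoint TX TZ := by
    rw [Finset.disjoint_left]
    intro e h1 h2
    exact hdisj _ (mem_inner.1 (hX.subset h1)).1 (mem_inner.1 (hZ.subset h2)).1
  have hinner : ∀ e ∈ G.inner X, e ∉ G.inner Z := fun e h1 h2 =>
    hdisj _ (mem_inner.1 h1).1 (mem_inner.1 h2).1
  refine ⟨fun e => if e ∈ G.inner X then SX e else if e ∈ G.inner Z then SZ e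
    else 8 * r / G.len e, ?_, ?_, ?_, ?_⟩
  · refine Finset.insert_subset heY (Finset.union_subset ?_ ?_)
    exacts [hX.subset.trans (inner_mono hXY), hZ.subset.trans (inner_mono hZY)]
  · rw [Finset.card_insert_of_notMem, Finset.card_union_of_disjoint hTd]
    · have h1 := hX.card
      have h2 := hZ.card
      have h3 : X.card + Z.card = Y.card := by
        rw [← Finset.card_filter_add_card_filter_not (s := Y) (a ≤ φ ·)]
        simp only [not_le, hXd, hZd]
      omega
    · rw [Finset.mem_union]
      rintro (h | h)
      exacts [heX (hX.subset h), heZ (hZ.subset h)]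
  · intro e he
    by_cases h1 : e ∈ G.inner X
    · obtain ⟨ρ, hρ, p⟩ := hX.route e h1
      refine ⟨ρ, by simpa [h1] using hρ, p.mono ?_ hXY⟩
      intro e' he'
      simp only [Finset.coe_insert, Finset.coe_union]
      exact Or.inr (Or.inl he')
    by_cases h2 : e ∈ G.inner Z
    · obtain ⟨ρ, hρ, p⟩ := hZ.route e h2
      refine ⟨ρ, by simpa [h1, h2] using hρ, p.mono ?_ hZY⟩
      intro e' he'
      simp only [Finset.coe_insert, Finset.coe_union]
      exact Or.inr (Or.inr he')
    · rw [mem_inner] at he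
      obtain ⟨ρ₁, hρ₁, p₁⟩ := hroute _ he.1
      obtain ⟨ρ₂, hρ₂, p₂⟩ := hroute _ he.2
      refine ⟨ρ₁ + ρ₂, ?_, p₁.symm.trans p₂⟩
      rw [if_neg h1, if_neg h2, div_mul_cancel₀ _ (G.len_pos e).ne']
      linarith
  · rw [sum_inner_split (φ := φ) (a := a)]
    have h1 : ∑ e ∈ G.inner X, μ e * (if e ∈ G.inner X then SX e else if e ∈ G.inner Z then SZ e
        else 8 * r / G.len e) = ∑ e ∈ G.inner X, μ e * SX e :=
      Finset.sum_congr rfl fun e he => by rw [if_pos he]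
    have h2 : ∑ e ∈ G.inner Z, μ e * (if e ∈ G.inner X then SX e else if e ∈ G.inner Z then SZ e
        else 8 * r / G.len e) = ∑ e ∈ G.inner Z, μ e * SZ e :=
      Finset.sum_congr rfl fun e he => by
        rw [if_neg fun h => hinner e h he, if_pos he]
    have h3 : ∑ e ∈ G.levelCut Y φ a, μ e * (if e ∈ G.inner X then SX e
        else if e ∈ G.inner Z then SZ e else 8 * r / G.len e) =
        8 * r * ∑ e ∈ G.levelCut Y φ a, μ e / G.len e := by
      rw [Finset.mul_sum]
      refine Finset.sum_congr rfl fun e he => ?_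
      have := (Finset.mem_filter.1 he).2
      rw [if_neg this.1, if_neg this.2]; ring
    rw [h1, h2, h3, vol_split (φ := φ) (a := a)]
    have h4 := mul_logb_superadditive hs (le_vol hμ hs.le (G := G) ⟨x, hx⟩)
      (le_vol hμ hs.le (G := G) ⟨y, hy⟩)
      (Finset.sum_nonneg fun e (_ : e ∈ G.levelCut Y φ a) => hμ e)
    have h5 : 8 * r * ∑ e ∈ G.levelCut Y φ a, μ e / G.len e ≤ 768 * N *
        (min (G.vol μ s X) (G.vol μ s Z) + ∑ e ∈ G.levelCut Y φ a, μ e) := by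
      refine (mul_le_mul_of_nonneg_left hcut (by positivity : 0 ≤ 8 * r)).trans_eq ?_
      field_simp
      ring
    have h6 := mul_le_mul_of_nonneg_left h4 (by positivity : (0 : ℝ) ≤ 768 * N)
    have h7 := hX.sum_le
    have h8 := hZ.sum_le
    linarith

/-- A sparse petal around a long enough highway. -/
theorem IsHighway.exists_petal (P : G.IsHighway ℓ Y x₀ k h b) (hμ : ∀ e, 0 ≤ μ e) (hs : 0 < s)
    (hN : (G.vol μ s Y / s) ^ 2 < 2 ^ N) (hℓ : ∀ e, 0 < ℓ e) (hlen : ∀ e, ℓ e ≤ G.len e)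
    (hc : G.ConnectedFrom ℓ Y x₀) {r α : ℝ} (hr : 0 < r) (hα : 0 < α)
    (hk : α + r / 4 ≤ G.metric ℓ Y x₀ (h k)) :
    ∃ φ : V → ℝ, ∃ a, α ≤ a ∧ a ≤ α + r / 4 ∧ φ = G.petalPotential ℓ Y x₀ k h ∧
      (∑ e ∈ G.levelCut Y φ a, μ e / G.len e ≤
        96 * N / r * (min (G.vol μ s (Y.filter (a ≤ φ ·))) (G.vol μ s (Y.filter (φ · < a))) +
          ∑ e ∈ G.levelCut Y φ a, μ e)) ∧
      ∃ m < k, (∀ i ≤ m, h i ∈ Y.filter (φ · < a)) ∧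
        (∀ i, m < i → i ≤ k → h i ∈ Y.filter (a ≤ φ ·)) ∧
        G.metric ℓ Y x₀ (h m) < a ∧ a ≤ G.metric ℓ Y x₀ (h (m + 1)) := by
  have hφ := fun i hi => P.petalPotential_highway hℓ hc (i := i) hi
  obtain ⟨a, ha1, ha2, hcut⟩ := exists_levelCut_le (G := G) hμ hs (α := α) hr hN
    (φ := G.petalPotential ℓ Y x₀ k h)
    (fun e u v hu hv hj => (P.petalPotential_sub_le hℓ hc hu hv hj).trans (by linarith [hlen e]))
    ⟨h k, P.mem k le_rfl, by rwa [hφ k le_rfl]⟩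
    ⟨h 0, P.mem 0 (by omega), by
      rwa [hφ 0 (by omega), P.start, metric_self hℓ P.center_mem]⟩
  obtain ⟨m, hm, h1, h2⟩ := P.exists_first hℓ (hα.trans_le ha1) (ha2.trans hk)
  refine ⟨_, a, ha1, ha2, rfl, hcut, m, hm, fun i hi => ?_, fun i hi hik => ?_,
    h1 m le_rfl, h2 _ (by omega) (by omega)⟩
  · exact Finset.mem_filter.2 ⟨P.mem i (by omega), by rw [hφ i (by omega)]; exact h1 i hi⟩
  · exact Finset.mem_filter.2 ⟨P.mem i hik, by rw [hφ i hik]; exact h2 i hi hik⟩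

theorem IsHighway.remainder_metric (P : G.IsHighway ℓ Y x₀ k h b) (hℓ : ∀ e, 0 < ℓ e)
    (hc : G.ConnectedFrom ℓ Y x₀) {a : ℝ} {z : V}
    (hz : z ∈ Y.filter (G.petalPotential ℓ Y x₀ k h · < a)) :
    G.metric ℓ (Y.filter (G.petalPotential ℓ Y x₀ k h · < a)) x₀ z = G.metric ℓ Y x₀ z := by
  have p := P.remainder_route hℓ hc hz
  exact le_antisymm (metric_le hℓ p)
    (metric_le hℓ ((route_metric hℓ p).mono subset_rfl (Finset.filter_subset _ _)))

/-- Distances from the start of the petal, with lengths on the highway scaled by `c`. -/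
theorem IsHighway.petal_metric (P : G.IsHighway ℓ Y x₀ k h b) (hℓ : ∀ e, 0 < ℓ e)
    (hc : G.ConnectedFrom ℓ Y x₀) (hℓ' : ∀ e, 0 < ℓ' e) {c a : ℝ} (hc0 : 0 < c) {m : ℕ}
    (hm : m < k)
    (hZ : ∀ i ≤ m, h i ∈ Y.filter (G.petalPotential ℓ Y x₀ k h · < a))
    (hX : ∀ i, m < i → i ≤ k → h i ∈ Y.filter (a ≤ G.petalPotential ℓ Y x₀ k h ·))
    (hle : ∀ e, c * ℓ e ≤ ℓ' e) (hle' : ∀ e, ℓ' e ≤ ℓ e)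
    (heq : ∀ i, m < i → i < k → ℓ' (b i) = c * ℓ (b i)) {z : V}
    (hz : z ∈ Y.filter (a ≤ G.petalPotential ℓ Y x₀ k h ·)) :
    ∃ ρ, G.Route ℓ' Set.univ (Y.filter (a ≤ G.petalPotential ℓ Y x₀ k h ·)) (h (m + 1)) z ρ ∧
      ∃ i ≤ k, ρ ≤ c * (G.metric ℓ Y x₀ (h i) - G.metric ℓ Y x₀ (h (m + 1))) +
        (G.metric ℓ Y x₀ z - (G.metric ℓ Y x₀ (h i) + a) / 2) := by
  obtain ⟨i, hi, hai, ρ₂, p₂, hρ₂⟩ := P.petal_route hℓ hc hz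
  obtain ⟨ρ₃, hρ₃, p₃⟩ := p₂.exists_le hle'
  have hmi : m < i := by
    by_contra! hcon
    have := (Finset.mem_filter.1 (hZ i hcon)).2
    rw [P.petalPotential_highway hℓ hc hi] at this
    linarith
  have p₁ := (P.drop hℓ hc hℓ' hc0 (m := m + 1) hm (Finset.filter_subset _ _)
    (fun i hi hik => hX i hi hik) hle (fun i hi hik => heq i hi hik)).1 (i - (m + 1)) (by omega)
  rw [Nat.add_sub_cancel' hmi] at p₁
  exact ⟨_, p₁.trans p₃, i, hi, by linarith⟩

/-- Low stretch trees of a petal and of its complement combine to a low stretch tree. -/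
theorem HasLowStretchTree.join {φ : V → ℝ} {a r β : ℝ} {e₀ : E} {x y : V}
    (hμ : ∀ e, 0 ≤ μ e) (hs : 0 < s) (hr : 0 < r) (hrad : ∀ z ∈ Y, G.metric ℓ Y x₀ z ≤ r)
    (hcut : ∑ e ∈ G.levelCut Y φ a, μ e / G.len e ≤
      96 * N / r * (min (G.vol μ s (Y.filter (a ≤ φ ·))) (G.vol μ s (Y.filter (φ · < a))) +
        ∑ e ∈ G.levelCut Y φ a, μ e))
    (hx : x ∈ Y.filter (a ≤ φ ·)) (hy : y ∈ Y.filter (φ · < a)) (hj : G.Joins e₀ y x)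
    {TX TZ : Finset E} {SX SZ : E → ℝ}
    (hX : G.IsLowStretchTree μ s N (Y.filter (a ≤ φ ·)) TX SX)
    (hZ : G.IsLowStretchTree μ s N (Y.filter (φ · < a)) TZ SZ)
    (hXr : ∀ z ∈ Y.filter (a ≤ φ ·), ∃ ρ, β + G.len e₀ + ρ ≤ 4 * G.metric ℓ Y x₀ z ∧
      G.Route G.len TX (Y.filter (a ≤ φ ·)) x z ρ)
    (hZr : ∀ z ∈ Y.filter (φ · < a), ∃ ρ ≤ 4 * G.metric ℓ Y x₀ z,
      G.Route G.len TZ (Y.filter (φ · < a)) x₀ z ρ)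
    (hyr : ∃ ρ ≤ β, G.Route G.len TZ (Y.filter (φ · < a)) x₀ y ρ)
    (hh : ∀ i ≤ k, (∃ ρ ≤ 2 * G.metric ℓ Y x₀ (h i),
        G.Route G.len TZ (Y.filter (φ · < a)) x₀ (h i) ρ) ∨
      ∃ ρ, β + G.len e₀ + ρ ≤ 2 * G.metric ℓ Y x₀ (h i) ∧
        G.Route G.len TX (Y.filter (a ≤ φ ·)) x (h i) ρ) :
    G.HasLowStretchTree μ s N ℓ Y x₀ k h := by
  obtain ⟨ρ₀, hρ₀, p₀⟩ := hyr
  have hXY : Y.filter (a ≤ φ ·) ⊆ Y := Finset.filter_subset _ _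
  have hZY : Y.filter (φ · < a) ⊆ Y := Finset.filter_subset _ _
  have hTX : (TX : Set E) ⊆ (insert e₀ (TX ∪ TZ) : Finset E) := by
    exact_mod_cast Finset.subset_union_left.trans (Finset.subset_insert _ _)
  have hTZ : (TZ : Set E) ⊆ (insert e₀ (TX ∪ TZ) : Finset E) := by
    exact_mod_cast Finset.subset_union_right.trans (Finset.subset_insert _ _)
  have key : ∀ z ρ, G.Route G.len TX (Y.filter (a ≤ φ ·)) x z ρ → ∃ ρ' ≤ β + G.len e₀ + ρ,
      G.Route G.len (insert e₀ (TX ∪ TZ) : Finset E) Y x₀ z ρ' := fun z ρ p =>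
    ⟨_, by gcongr, ((p₀.mono hTZ hZY).trans
      (.single hj (by simp) (hZY hy) (hXY hx))).trans (p.mono hTX hXY)⟩
  have hroute : ∀ z ∈ Y, ∃ ρ ≤ 4 * G.metric ℓ Y x₀ z,
      G.Route G.len (insert e₀ (TX ∪ TZ) : Finset E) Y x₀ z ρ := by
    intro z hz
    by_cases hza : φ z < a
    · obtain ⟨ρ, hρ, p⟩ := hZr z (Finset.mem_filter.2 ⟨hz, hza⟩)
      exact ⟨ρ, hρ, p.mono hTZ hZY⟩
    · obtain ⟨ρ, hρ, p⟩ := hXr z (Finset.mem_filter.2 ⟨hz, not_lt.1 hza⟩)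
      obtain ⟨ρ', hρ', p'⟩ := key z ρ p
      exact ⟨ρ', hρ'.trans hρ, p'⟩
  obtain ⟨S, hS⟩ := hX.glue hμ hs hr hcut hZ hx hy hj fun z hz => by
    obtain ⟨ρ, hρ, p⟩ := hroute z hz
    exact ⟨ρ, by linarith [hrad z hz], p⟩
  refine ⟨_, S, hS, hroute, fun i hi => ?_⟩
  rcases hh i hi with ⟨ρ, hρ, p⟩ | ⟨ρ, hρ, p⟩
  · exact ⟨ρ, hρ, p.mono hTZ hZY⟩
  · obtain ⟨ρ', hρ', p'⟩ := key _ ρ p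
    exact ⟨ρ', hρ'.trans hρ, p'⟩

theorem IsCluster.hasLowStretchTree_of_card_eq_one (C : G.IsCluster ℓ Y x₀ k h b)
    (hμ : ∀ e, 0 ≤ μ e) (hs : 0 < s) (hY : Y = {x₀}) :
    G.HasLowStretchTree μ s N ℓ Y x₀ k h := by
  subst hY
  have h0 : ∀ z ∈ ({x₀} : Finset V), z = x₀ := fun z hz => Finset.mem_singleton.1 hz
  refine ⟨∅, 0, ⟨by simp, by simp, fun e he => ⟨0, by simp, ?_⟩, ?_⟩, fun z hz => ⟨0, ?_, ?_⟩,
    fun i hi => ⟨0, ?_, ?_⟩⟩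
  · rw [mem_inner] at he
    rw [h0 _ he.1, h0 _ he.2]
    exact .nil (by simp)
  · have h1 := le_vol (G := G) hμ hs.le (Finset.singleton_nonempty x₀)
    have h2 : 0 ≤ Real.logb 2 (G.vol μ s {x₀} / s) :=
      Real.logb_nonneg (by norm_num) (by rwa [one_le_div hs])
    have h3 : 0 ≤ G.vol μ s {x₀} := hs.le.trans h1
    simp only [Pi.zero_apply, mul_zero, Finset.sum_const_zero]
    positivity
  · have := metric_nonneg (G := G) (Y := {x₀}) (u := x₀) (v := z) C.pos; positivity
  · rw [h0 z hz]; exact .nil (by simp)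
  · have := metric_nonneg (G := G) (Y := {x₀}) (u := x₀) (v := h i) C.pos; positivity
  · rw [h0 _ (C.highway.mem i hi)]; exact .nil (by simp)

/-- The step in which the petal is cut off along the highway of the cluster. -/
theorem IsCluster.step_of_le (C : G.IsCluster ℓ Y x₀ k h b) (hμ : ∀ e, 0 ≤ μ e) (hs : 0 < s)
    (hN : (G.vol μ s Y / s) ^ 2 < 2 ^ N)
    (ih : ∀ Z ⊂ Y, ∀ ℓ y k h b, G.IsCluster ℓ Z y k h b → G.HasLowStretchTree μ s N ℓ Z y k h)
    {r : ℝ} (hr : 0 < r) (hrad : ∀ z ∈ Y, G.metric ℓ Y x₀ z ≤ r)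
    (hk : 3 / 4 * r ≤ G.metric ℓ Y x₀ (h k)) : G.HasLowStretchTree μ s N ℓ Y x₀ k h := by
  have P := C.highway
  have hc := C.connected
  have hℓ := C.pos
  obtain ⟨φ, a, ha1, ha2, rfl, hcut, m, hm, hZm, hXm, hya, hax⟩ :=
    P.exists_petal hμ hs hN hℓ C.le_len hc hr (α := r / 2) (by positivity) (by linarith)
  have hmetX := fun z hz => P.petal_metric hℓ hc hℓ one_pos hm hZm hXm (c := 1) (z := z)
    (fun e => (one_mul _).le) (fun e => le_rfl) (fun i _ _ => (one_mul _).symm) hz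
  have hdropX := P.drop hℓ hc hℓ one_pos (m := m + 1) hm (Finset.filter_subset _ _)
    (fun i hi hik => hXm i hi hik) (fun e => (one_mul _).le) (fun i _ _ => (one_mul _).symm)
  have hmetZ := fun z hz => P.remainder_metric hℓ hc (a := a) (z := z) hz
  set X := Y.filter (a ≤ G.petalPotential ℓ Y x₀ k h ·)
  set Z := Y.filter (G.petalPotential ℓ Y x₀ k h · < a)
  have hXZ : ∀ v, v ∈ X → v ∉ Z := fun v h1 h2 => by
    linarith [(Finset.mem_filter.1 h1).2, (Finset.mem_filter.1 h2).2]
  have hx : h (m + 1) ∈ X := hXm _ (by omega) (by omega)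
  have hy : h m ∈ Z := hZm _ le_rfl
  have hXY : X ⊆ Y := Finset.filter_subset _ _
  have hZY : Z ⊆ Y := Finset.filter_subset _ _
  have CX : G.IsCluster ℓ X (h (m + 1)) (k - (m + 1)) (fun j => h (m + 1 + j))
      (fun j => b (m + 1 + j)) := by
    refine ⟨fun z hz => ?_, C.len_le, C.le_len, fun e u v hu hv hj hne =>
      C.eq_len e u v (hXY hu) (hXY hv) hj fun i hi hiu => ?_, hdropX.2.2⟩
    · obtain ⟨ρ, p, -⟩ := hmetX z hz
      exact ⟨ρ, p⟩
    · rcases le_or_gt i m with him | him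
      · exact hXZ u hu (hiu ▸ hZm i him)
      · refine hne (i - (m + 1)) (by omega) ?_
        rwa [Nat.add_sub_cancel' him]
  have CZ : G.IsCluster ℓ Z x₀ m h b := by
    refine ⟨fun z hz => ⟨_, P.remainder_route hℓ hc hz⟩, C.len_le, C.le_len,
      fun e u v hu hv hj hne => C.eq_len e u v (hZY hu) (hZY hv) hj fun i hi hiu => ?_,
      P.truncate hm.le hZm hmetZ⟩
    rcases le_or_gt i m with him | him
    · exact hne i him hiu
    · exact hXZ u (hiu ▸ hXm i him hi) hu
  obtain ⟨TX, SX, hTX, hX1, hX2⟩ := ih X (hXY.ssubset_of_ne fun heq =>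
    hXZ (h m) (heq ▸ hZY hy) hy) _ _ _ _ _ CX
  obtain ⟨TZ, SZ, hTZ, hZ1, hZ2⟩ := ih Z (hZY.ssubset_of_ne fun heq =>
    hXZ _ hx (heq ▸ hXY hx)) _ _ _ _ _ CZ
  have hgrow := P.grow m hm
  have hlen := C.len_le (b m)
  refine HasLowStretchTree.join hμ hs hr hrad hcut hx hy (P.joins m hm) hTX hTZ
    (β := 2 * G.metric ℓ Y x₀ (h m)) (fun z hz => ?_) (fun z hz => ?_) ?_ fun i hi => ?_
  · obtain ⟨ρ, hρ, p⟩ := hX1 z hz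
    obtain ⟨ρ', p', i, hi, hρ'⟩ := hmetX z hz
    refine ⟨ρ, ?_, p⟩
    have := metric_le hℓ p'
    have := hrad _ (P.mem i hi)
    linarith
  · rw [← hmetZ z hz]; exact hZ1 z hz
  · rw [← hmetZ _ hy]; exact hZ2 m le_rfl
  · rcases le_or_gt i m with him | him
    · left
      rw [← hmetZ _ (hZm i him)]; exact hZ2 i him
    · right
      obtain ⟨ρ, hρ, p⟩ := hX2 (i - (m + 1)) (by omega)
      rw [hdropX.2.1 _ (by omega)] at hρ
      have hmi : m + 1 + (i - (m + 1)) = i := by omega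
      simp only [hmi] at hρ p
      exact ⟨ρ, by linarith, p⟩

/-- The step in which the petal is cut off towards a farthest vertex. -/
theorem IsCluster.step_of_lt (C : G.IsCluster ℓ Y x₀ k h b) (hμ : ∀ e, 0 ≤ μ e) (hs : 0 < s)
    (hN : (G.vol μ s Y / s) ^ 2 < 2 ^ N)
    (ih : ∀ Z ⊂ Y, ∀ ℓ y k h b, G.IsCluster ℓ Z y k h b → G.HasLowStretchTree μ s N ℓ Z y k h)
    {r : ℝ} (hr : 0 < r) (hrad : ∀ z ∈ Y, G.metric ℓ Y x₀ z ≤ r)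
    {k' : ℕ} {h' : ℕ → V} {b' : ℕ → E} (P : G.IsHighway ℓ Y x₀ k' h' b')
    (hk' : G.metric ℓ Y x₀ (h' k') = r)
    (hk : G.metric ℓ Y x₀ (h k) < 3 / 4 * r) : G.HasLowStretchTree μ s N ℓ Y x₀ k h := by
  have hc := C.connected
  have hℓ := C.pos
  obtain ⟨φ, a, ha1, ha2, rfl, hcut, m, hm, hZm, hXm, hya, hax⟩ :=
    P.exists_petal hμ hs hN hℓ C.le_len hc hr (α := 3 / 4 * r) (by positivity) (by linarith)
  let ℓ' : E → ℝ := fun e =>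
    if ∃ u v, G.Joins e u v ∧ (∃ i, m < i ∧ i ≤ k' ∧ h' i = u) ∧ ∃ i, m < i ∧ i ≤ k' ∧ h' i = v
    then 1 / 2 * ℓ e else ℓ e
  have hle : ∀ e, 1 / 2 * ℓ e ≤ ℓ' e := fun e => by
    have := hℓ e
    simp only [ℓ']; split_ifs <;> linarith
  have hle' : ∀ e, ℓ' e ≤ ℓ e := fun e => by
    have := hℓ e
    simp only [ℓ']; split_ifs <;> linarith
  have hℓ' : ∀ e, 0 < ℓ' e := fun e => by linarith [hle e, hℓ e]
  have heq : ∀ i, m < i → i < k' → ℓ' (b' i) = 1 / 2 * ℓ (b' i) := fun i hi hik =>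
    if_pos ⟨_, _, P.joins i hik, ⟨i, hi, hik.le, rfl⟩, i + 1, by omega, by omega, rfl⟩
  have hmetX := fun z hz => P.petal_metric hℓ hc hℓ' one_half_pos hm hZm hXm (z := z)
    hle hle' heq hz
  have hdropX := P.drop hℓ hc hℓ' one_half_pos (m := m + 1) hm (Finset.filter_subset _ _)
    (fun i hi hik => hXm i hi hik) hle (fun i hi hik => heq i hi hik)
  have hmetZ := fun z hz => P.remainder_metric hℓ hc (a := a) (z := z) hz
  have hhZ : ∀ i ≤ k, h i ∈ Y.filter (G.petalPotential ℓ Y x₀ k' h' · < a) := fun i hi =>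
    Finset.mem_filter.2 ⟨C.highway.mem i hi,
      (P.petalPotential_le hℓ hc (C.highway.mem i hi)).trans_lt
        (((C.highway.metric_mono hℓ hi le_rfl).trans_lt hk).trans_le ha1)⟩
  set X := Y.filter (a ≤ G.petalPotential ℓ Y x₀ k' h' ·)
  set Z := Y.filter (G.petalPotential ℓ Y x₀ k' h' · < a)
  have hXZ : ∀ v, v ∈ X → v ∉ Z := fun v h1 h2 => by
    linarith [(Finset.mem_filter.1 h1).2, (Finset.mem_filter.1 h2).2]
  have hx : h' (m + 1) ∈ X := hXm _ (by omega) (by omega)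
  have hy : h' m ∈ Z := hZm _ le_rfl
  have hXY : X ⊆ Y := Finset.filter_subset _ _
  have hZY : Z ⊆ Y := Finset.filter_subset _ _
  have hXlen : ∀ e u v, u ∈ X → v ∈ X → G.Joins e u v → ℓ e = G.len e := fun e u v hu hv hj =>
    C.eq_len e u v (hXY hu) (hXY hv) hj fun i hi hiu => hXZ u hu (hiu ▸ hhZ i hi)
  have CX : G.IsCluster ℓ' X (h' (m + 1)) (k' - (m + 1)) (fun j => h' (m + 1 + j))
      (fun j => b' (m + 1 + j)) := by
    refine ⟨fun z hz => ?_, fun e => ?_, fun e => (hle' e).trans (C.le_len e),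
      fun e u v hu hv hj hne => ?_, hdropX.2.2⟩
    · obtain ⟨ρ, p, -⟩ := hmetX z hz
      exact ⟨ρ, p⟩
    · simp only [ℓ']
      split_ifs with he
      · obtain ⟨u, v, hj, ⟨i, hi, hik, rfl⟩, j, hj', hjk, rfl⟩ := he
        rw [hXlen e _ _ (hXm i hi hik) (hXm j hj' hjk) hj]
        linarith
      · exact C.len_le e
    · rw [← hXlen e u v hu hv hj]
      refine if_neg ?_
      have hnot : ¬ ∃ i, m < i ∧ i ≤ k' ∧ h' i = u := by
        rintro ⟨i, hi, hik, hiu⟩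
        refine hne (i - (m + 1)) (by omega) ?_
        rwa [Nat.add_sub_cancel' hi]
      rintro ⟨u', v', hj', hu', hv'⟩
      rcases hj with h1 | h1 <;> rcases hj' with h2 | h2 <;> rw [h1, Prod.mk.injEq] at h2
      · exact hnot (h2.1 ▸ hu')
      · exact hnot (h2.1 ▸ hv')
      · exact hnot (h2.2 ▸ hv')
      · exact hnot (h2.2 ▸ hu')
  have CZ : G.IsCluster ℓ Z x₀ k h b :=
    ⟨fun z hz => ⟨_, P.remainder_route hℓ hc hz⟩, C.len_le, C.le_len,
      fun e u v hu hv hj hne => C.eq_len e u v (hZY hu) (hZY hv) hj hne,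
      C.highway.truncate le_rfl hhZ hmetZ⟩
  obtain ⟨TX, SX, hTX, hX1, -⟩ := ih X (hXY.ssubset_of_ne fun heq =>
    hXZ (h' m) (heq ▸ hZY hy) hy) _ _ _ _ _ CX
  obtain ⟨TZ, SZ, hTZ, hZ1, hZ2⟩ := ih Z (hZY.ssubset_of_ne fun heq =>
    hXZ _ hx (heq ▸ hXY hx)) _ _ _ _ _ CZ
  have hgrow := P.grow m hm
  have hlen := C.len_le (b' m)
  refine HasLowStretchTree.join hμ hs hr hrad hcut hx hy (P.joins m hm) hTX hTZ
    (β := 4 * G.metric ℓ Y x₀ (h' m)) (fun z hz => ?_) (fun z hz => ?_) ?_ fun i hi => ?_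
  · obtain ⟨ρ, hρ, p⟩ := hX1 z hz
    obtain ⟨ρ', p', i, hi, hρ'⟩ := hmetX z hz
    refine ⟨ρ, ?_, p⟩
    have := metric_le hℓ' p'
    linarith
  · rw [← hmetZ z hz]; exact hZ1 z hz
  · rw [← hmetZ _ hy]; exact hZ1 _ hy
  · left
    rw [← hmetZ _ (hhZ i hi)]; exact hZ2 i hi

/-- Every cluster has a low stretch tree. -/
theorem IsCluster.hasLowStretchTree [Nonempty E] (C : G.IsCluster ℓ Y x₀ k h b)
    (hμ : ∀ e, 0 ≤ μ e) (hs : 0 < s) (hN : (G.vol μ s Y / s) ^ 2 < 2 ^ N) :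
    G.HasLowStretchTree μ s N ℓ Y x₀ k h := by
  induction Y using Finset.strongInduction generalizing ℓ x₀ k h b with
  | H Y ih =>
    have hx := C.highway.center_mem
    have ih' : ∀ Z ⊂ Y, ∀ ℓ y k h b, G.IsCluster ℓ Z y k h b →
        G.HasLowStretchTree μ s N ℓ Z y k h := fun Z hZ ℓ y k h b CZ => by
      refine ih Z hZ CZ (lt_of_le_of_lt ?_ hN)
      have h1 := vol_mono (G := G) hμ hs.le hZ.subset
      have h2 := hs.le.trans (le_vol (G := G) hμ hs.le ⟨y, CZ.highway.center_mem⟩)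
      gcongr
    obtain ⟨p, hp, hmax⟩ := Y.exists_max_image (G.metric ℓ Y x₀) ⟨x₀, hx⟩
    by_cases hpx : Y = {x₀}
    · exact C.hasLowStretchTree_of_card_eq_one hμ hs hpx
    obtain ⟨z, hz, hzx⟩ : ∃ z ∈ Y, z ≠ x₀ := by
      by_contra! hcon
      exact hpx (Finset.eq_singleton_iff_unique_mem.2 ⟨hx, hcon⟩)
    have hr : 0 < G.metric ℓ Y x₀ p :=
      ((C.connected.route C.pos hx hz).pos C.pos hzx.symm).trans_le (hmax z hz)
    rcases le_or_gt (3 / 4 * G.metric ℓ Y x₀ p) (G.metric ℓ Y x₀ (h k)) with hk | hk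
    · exact C.step_of_le hμ hs hN ih' hr hmax hk
    · obtain ⟨k', h', b', P, rfl⟩ := exists_highway C.pos C.connected hp
      exact C.step_of_lt hμ hs hN ih' hr hmax P rfl hk

end WGraph

namespace WGraph

variable {V E : Type} {G : WGraph V E}

theorem Walk.exists_route [Fintype V] {u v : V} (p : G.Walk u v) (ℓ : E → ℝ) :
    ∃ r, G.Route ℓ Set.univ Finset.univ u v r := by
  induction p with
  | nil u => exact ⟨0, .nil (Finset.mem_univ _)⟩
  | cons u v x e h p ih =>
    obtain ⟨r, q⟩ := ih
    exact ⟨_, .cons h trivial (Finset.mem_univ _) q⟩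

theorem Walk.length_nonneg {u v : V} (p : G.Walk u v) : 0 ≤ p.length := by
  induction p with
  | nil => exact le_rfl
  | cons u v x e h p ih => exact add_nonneg (G.len_pos e).le ih

theorem Route.exists_walk {T : Set E} {Y : Finset V} {u v : V} {r : ℝ}
    (p : G.Route G.len T Y u v r) : ∃ q : (G.restrictE T).Walk u v, q.length = r := by
  induction p with
  | nil => exact ⟨.nil _, rfl⟩
  | @cons u v x e r hj he _ _ ih =>
    obtain ⟨q, rfl⟩ := ih
    exact ⟨.cons u v x ⟨e, he⟩ hj q, rfl⟩

theorem Route.dist_le {T : Set E} {Y : Finset V} {u v : V} {r : ℝ}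
    (p : G.Route G.len T Y u v r) : (G.restrictE T).dist u v ≤ r :=
  csInf_le ⟨0, by rintro _ ⟨q, rfl⟩; exact q.length_nonneg⟩ p.exists_walk

theorem Connected.nonempty_edges [Nontrivial V] (hG : G.Connected) : Nonempty E := by
  obtain ⟨u, v, huv⟩ := exists_pair_ne V
  obtain ⟨p⟩ := hG u v
  cases p with
  | nil => exact absurd rfl huv
  | cons _ _ _ e => exact ⟨e⟩

/-- A spanning tree of small average stretch, for a given distribution on the edges. -/
theorem Connected.exists_isSpanningTree [Fintype V] [Fintype E] [Nontrivial V]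
    (hG : G.Connected) {μ : E → ℝ} (hμ : ∀ e, 0 ≤ μ e) (hμ1 : ∑ e, μ e = 1) :
    ∃ T, G.IsSpanningTree T ∧
      ∑ e, μ e * G.stretch T e ≤ 4608 * Real.logb 2 (2 * Fintype.card V) ^ 2 := by
  have : Nonempty E := hG.nonempty_edges
  have hn : (2 : ℝ) ≤ Fintype.card V := by
    exact_mod_cast Fintype.one_lt_card_iff_nontrivial.2 ‹Nontrivial V›
  set n : ℝ := (Fintype.card V : ℝ)
  have hn0 : 0 < n := by linarith
  set L := Real.logb 2 (2 * n) with hL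
  have hL1 : 1 ≤ L := by
    rw [hL, Real.le_logb_iff_rpow_le (by norm_num) (by positivity)]
    norm_num; linarith
  have huniv : G.inner Finset.univ = Finset.univ := by ext e; simp [mem_inner]
  have hvol : G.vol μ (1 / n) Finset.univ = 2 := by
    rw [vol, huniv, hμ1, Finset.card_univ, one_div_mul_cancel hn0.ne']; norm_num
  have hvols : G.vol μ (1 / n) Finset.univ / (1 / n) = 2 * n := by rw [hvol]; field_simp
  set N := ⌊2 * L⌋₊ + 1 with hNd
  have hN : (G.vol μ (1 / n) Finset.univ / (1 / n)) ^ 2 < 2 ^ N := by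
    rw [hvols, ← Real.rpow_natCast 2 N, ← Real.logb_lt_iff_lt_rpow (by norm_num) (by positivity),
      Real.logb_pow, ← hL, hNd]
    push_cast
    exact Nat.lt_floor_add_one _
  have hNL : (N : ℝ) ≤ 3 * L := by
    rw [hNd]; push_cast
    linarith [Nat.floor_le (by linarith : 0 ≤ 2 * L)]
  obtain ⟨x₀⟩ : Nonempty V := inferInstance
  have C : G.IsCluster G.len Finset.univ x₀ 0 (fun _ => x₀) (fun _ => Classical.arbitrary E) := by
    refine ⟨fun z _ => (hG x₀ z).some.exists_route _, fun e => ?_, fun e => le_rfl,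
      fun _ _ _ _ _ _ _ => rfl, rfl, fun _ _ => Finset.mem_univ _, by simp, by simp⟩
    linarith [G.len_pos e]
  obtain ⟨T, S, hT, hr, -⟩ := C.hasLowStretchTree hμ (by positivity : 0 < 1 / n) hN
  refine ⟨T, ⟨fun u v => ?_, hT.card⟩, ?_⟩
  · obtain ⟨ρ₁, -, p₁⟩ := hr u (Finset.mem_univ _)
    obtain ⟨ρ₂, -, p₂⟩ := hr v (Finset.mem_univ _)
    obtain ⟨q, -⟩ := (p₁.symm.trans p₂).exists_walk
    exact ⟨q⟩
  · have h1 := hT.sum_le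
    rw [huniv, hvols, hvol, ← hL] at h1
    calc _ ≤ ∑ e, μ e * S e := by
          refine Finset.sum_le_sum fun e _ => mul_le_mul_of_nonneg_left ?_ (hμ e)
          obtain ⟨ρ, hρ, p⟩ := hT.route e (huniv ▸ Finset.mem_univ e)
          rw [stretch, div_le_iff₀ (G.len_pos e)]
          exact p.dist_le.trans hρ
      _ ≤ _ := h1
      _ ≤ 768 * (3 * L) * (2 * L) := by gcongr
      _ = _ := by ring

/-- A distribution over spanning trees of small expected stretch. -/
theorem Connected.exists_distribution [Fintype V] [Fintype E] [Nontrivial V]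
    (hG : G.Connected) :
    ∃ (h : ℕ) (Ts : Fin h → Finset E) (Pr : Fin h → ℝ),
      (∀ i, G.IsSpanningTree (Ts i)) ∧ (∀ i, 0 ≤ Pr i) ∧ (∑ i, Pr i) = 1 ∧
      ∀ e : E, (∑ i, Pr i * G.stretch (Ts i) e) ≤
        4608 * Real.logb 2 (2 * Fintype.card V) ^ 2 := by
  have : Nonempty E := hG.nonempty_edges
  obtain ⟨T₀, hT₀, -⟩ := hG.exists_isSpanningTree (μ := Pi.single (Classical.arbitrary E) 1)
    (fun e => by rw [Pi.single_apply]; split_ifs <;> norm_num) (by simp)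
  have : Nonempty {T : Finset E // G.IsSpanningTree T} := ⟨⟨T₀, hT₀⟩⟩
  obtain ⟨p, hp0, hp1, hp⟩ := exists_mixture_le
    (fun (T : {T : Finset E // G.IsSpanningTree T}) e => G.stretch T.1 e)
    (4608 * Real.logb 2 (2 * Fintype.card V) ^ 2) fun μ hμ hμ1 => by
      obtain ⟨T, hT, h⟩ := hG.exists_isSpanningTree hμ hμ1
      exact ⟨⟨T, hT⟩, h⟩
  let f := (Fintype.equivFin {T : Finset E // G.IsSpanningTree T}).symm
  refine ⟨_, fun i => (f i).1, fun i => p (f i), fun i => (f i).2, fun i => hp0 _, ?_, fun e => ?_⟩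
  · rw [← hp1]; exact f.sum_comp p
  · exact (f.sum_comp fun T => p T * G.stretch T.1 e).trans_le (hp e)

end WGraph

theorem logb_two_mul_sq_le {n : ℝ} (hn : 4 ≤ n) :
    4608 * Real.logb 2 (2 * n) ^ 2 ≤ 10368 / (Real.log 2 ^ 2 * Real.log (Real.log 4)) *
      Real.log n ^ 2 * Real.log (Real.log n) := by
  have h2 : 0 < Real.log 2 := Real.log_pos (by norm_num)
  have h4 : Real.log 4 = 2 * Real.log 2 := by
    rw [show (4 : ℝ) = 2 ^ 2 by norm_num, Real.log_pow]; norm_num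
  have h41 : 1 < Real.log 4 := by rw [h4]; linarith [Real.log_two_gt_d9]
  have hll : 0 < Real.log (Real.log 4) := Real.log_pos h41
  have hl : Real.log 4 ≤ Real.log n := Real.log_le_log (by norm_num) hn
  have hll' : Real.log (Real.log 4) ≤ Real.log (Real.log n) :=
    Real.log_le_log (by linarith) hl
  have hL : Real.logb 2 (2 * n) ≤ 3 / 2 * Real.log n / Real.log 2 := by
    rw [Real.logb, Real.log_mul (by norm_num) (by linarith)]
    gcongr
    linarith
  have hL0 : 0 ≤ Real.logb 2 (2 * n) := Real.logb_nonneg (by norm_num) (by linarith)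
  calc _ ≤ 4608 * (3 / 2 * Real.log n / Real.log 2) ^ 2 := by gcongr
    _ = 10368 / (Real.log 2 ^ 2 * Real.log (Real.log 4)) *
      Real.log n ^ 2 * Real.log (Real.log 4) := by field_simp; ring
    _ ≤ _ := by gcongr

/-- A probability distribution over subgraph spanning trees with
expected stretch `O((log n)² log log n)` for every edge. -/
theorem distribution_over_spanning_trees :
    ∃ C : ℝ, ∀ (V E : Type) [Fintype V] [Fintype E] (G : WGraph V E),
      G.Connected → 4 ≤ Fintype.card V →
      ∃ (h : ℕ) (Ts : Fin h → Finset E) (Pr : Fin h → ℝ),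
        (∀ i, G.IsSpanningTree (Ts i)) ∧ (∀ i, 0 ≤ Pr i) ∧
        (∑ i, Pr i) = 1 ∧
        ∀ e : E, (∑ i, Pr i * G.stretch (Ts i) e) ≤
          C * Real.log (Fintype.card V) ^ 2 *
            Real.log (Real.log (Fintype.card V)) := by
  refine ⟨10368 / (Real.log 2 ^ 2 * Real.log (Real.log 4)), fun V E _ _ G hG hV => ?_⟩
  have : Nontrivial V := Fintype.one_lt_card_iff_nontrivial.1 (by omega)
  obtain ⟨h, Ts, Pr, hT, h0, h1, hs⟩ := hG.exists_distribution
  exact ⟨h, Ts, Pr, hT, h0, h1, fun e =>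
    (hs e).trans (logb_two_mul_sq_le (by exact_mod_cast hV))⟩
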